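/- Consider a transportation network with flow-density functions satisfying the standing assumptions, a throughput λ with 0 < λ < C^mincut, and a Lipschitz decentralized monotone feedback pricing policy ω. For each β > 0, let Z_β ⊆ Z be a nonempty compact convex set contained in the relative interior Z° of Z with sup_{z∈Z_β} (Az)_i < C_i for each link i, suppose Z_β converges to the closure of Z in the Hausdorff metric as β → ∞, and let the closed-loop dynamics use the perturbed best response F^h associated to the admissible perturbation h(z) = β^{-1} ∑_γ z_γ log z_γ on Z_β. Then there exists a perturbed equilibrium flow y^{(ω,β)} ∈ F and a nondecreasing function δ̄ : (0,∞) → ℝ₊ with lim_{η→0+} δ̄(η) = 0 such that for every update rate η > 0 and every solution of the closed-loop dynamics with initial condition (z(0), x(0)) ∈ Z° × ℝ₊^E, limsup_{t→∞} ‖y(t) − y^{(ω,β)}‖₂ ≤ δ̄(η). Moreover, lim_{β→∞} y^{(ω,β)} = y^{(ω)}, the unique generalized Wardrop equilibrium of throughput λ for the pricing policy ω. -/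

import Mathlib

open Set Filter Topology

noncomputable section

namespace Traffic

/-- The standing assumptions on a flow-density function `φ`: twice continuously
differentiable, strictly increasing and strictly concave on `[0,∞)`, with `φ 0 = 0`
(finiteness of `φ'(0)` is automatic for real-valued `φ`). -/
def Standing (φ : ℝ → ℝ) : Prop :=
  ContDiffOn ℝ 2 φ (Set.Ici 0) ∧ StrictMonoOn φ (Set.Ici 0) ∧
    StrictConcaveOn ℝ (Set.Ici 0) φ ∧ φ 0 = 0

/-- The capacity `C = sup {φ x : x ≥ 0}`, as an extended nonnegative real. -/
def cap (φ : ℝ → ℝ) : ENNReal := ⨆ x ∈ Set.Ici (0:ℝ), ENNReal.ofReal (φ x)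

/-- The inverse of `φ` on `[0,∞)`. -/
def phiInv (φ : ℝ → ℝ) (y : ℝ) : ℝ := Function.invFunOn φ (Set.Ici 0) y

/-- The latency function `τ` associated to a flow-density function `φ`:
`τ 0 = 1/φ'(0)` and `τ y = φ⁻¹(y)/y` for `y ≠ 0`. -/
def latency (φ : ℝ → ℝ) (y : ℝ) : ℝ :=
  if y = 0 then 1 / derivWithin φ (Set.Ici 0) 0 else phiInv φ y / y

/-- The domain `[0, C)` of the latency function. -/
def latDom (φ : ℝ → ℝ) : Set ℝ := {y | 0 ≤ y ∧ ENNReal.ofReal y < cap φ}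

variable {V E : Type*}

/-- Node-link incidence matrix. -/
def Bmat [DecidableEq V] (θ κ : E → V) (v : V) (i : E) : ℝ :=
  if v = θ i then 1 else if v = κ i then -1 else 0

/-- `p` is a simple path from `o` to `d`: nonempty list of links, starting at `o`,
ending at `d`, consecutive, and visiting no node twice. -/
def IsSimplePath (θ κ : E → V) (o d : V) (p : List E) : Prop :=
  p ≠ [] ∧ (p.map θ).head? = some o ∧ (p.map κ).getLast? = some d ∧
    List.Chain' (fun a b => κ a = θ b) p ∧ (o :: p.map κ).Nodup

/-- The type of simple paths from `o` to `d`. -/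
abbrev Path (θ κ : E → V) (o d : V) := {p : List E // IsSimplePath θ κ o d p}

/-- Link-path incidence matrix. -/
def Amat [DecidableEq E] (θ κ : E → V) (o d : V) (i : E) (γ : Path θ κ o d) : ℝ :=
  if i ∈ γ.1 then 1 else 0

/-- The flow `y^z = A z` associated to a path preference vector `z`. -/
def flowOf [Fintype E] [DecidableEq E] (θ κ : E → V) (o d : V) [Fintype (Path θ κ o d)]
    (z : Path θ κ o d → ℝ) (i : E) : ℝ :=
  ∑ γ, Amat θ κ o d i γ * z γ

/-- The simplex `S_λ` of path preference vectors of total mass `lam`. -/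
def pathSimplex (lam : ℝ) (Γ : Type*) [Fintype Γ] : Set (Γ → ℝ) :=
  {z | (∀ γ, 0 ≤ z γ) ∧ ∑ γ, z γ = lam}

/-- The set `F` of feasible flows. -/
def feas [Fintype E] (φ : E → ℝ → ℝ) : Set (E → ℝ) :=
  {y | ∀ i, 0 ≤ y i ∧ ENNReal.ofReal (y i) < cap (φ i)}

/-- The set of `o`-`d` equilibrium flow vectors of throughput `lam`. -/
def eqFlow [Fintype E] [DecidableEq V] (θ κ : E → V) (o d : V) (lam : ℝ) :
    Set (E → ℝ) :=
  {y | (∀ i, 0 ≤ y i) ∧ ∀ v, (∑ i, Bmat θ κ v i * y i) =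
      lam * ((if v = o then (1:ℝ) else 0) - (if v = d then 1 else 0))}

/-- The min-cut capacity between `o` and `d`. -/
def minCut [Fintype V] [Fintype E] [DecidableEq V] (θ κ : E → V) (o d : V)
    (φ : E → ℝ → ℝ) : ENNReal :=
  ⨅ U ∈ {U : Finset V | o ∈ U ∧ d ∉ U},
    ∑ i ∈ Finset.univ.filter (fun i => θ i ∈ U ∧ κ i ∉ U), cap (φ i)

/-- The total latency `L(y) = ∑ i, y i * τ_i (y i)`. -/
def totLat [Fintype E] (φ : E → ℝ → ℝ) (y : E → ℝ) : ℝ :=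
  ∑ i, y i * latency (φ i) (y i)

/-- A decentralized monotone feedback pricing policy: on each link, a nondecreasing
nonnegative function of the flow on that link only. -/
def MonotonePolicy [Fintype E] (φ ω : E → ℝ → ℝ) : Prop :=
  ∀ i, MonotoneOn (ω i) (latDom (φ i)) ∧ ∀ y ∈ latDom (φ i), 0 ≤ ω i y

/-- A Lipschitz (decentralized) pricing policy. -/
def LipschitzPolicy [Fintype E] (φ ω : E → ℝ → ℝ) : Prop :=
  ∀ i, ∃ K : NNReal, LipschitzOnWith K (ω i) (latDom (φ i))

/-- Perceived cost (total latency plus total toll) of path `γ` at flow `y`. -/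
def pathCost [Fintype E] [DecidableEq E] (θ κ : E → V) (o d : V)
    [Fintype (Path θ κ o d)] (φ ω : E → ℝ → ℝ) (y : E → ℝ) (γ : Path θ κ o d) : ℝ :=
  ∑ i, Amat θ κ o d i γ * (latency (φ i) (y i) + ω i (y i))

/-- Generalized Wardrop equilibrium with feedback pricing. -/
def IsGWE [Fintype E] [DecidableEq V] [DecidableEq E] (θ κ : E → V) (o d : V)
    [Fintype (Path θ κ o d)] (φ ω : E → ℝ → ℝ) (lam : ℝ) (y : E → ℝ) : Prop :=
  y ∈ feas φ ∧ y ∈ eqFlow θ κ o d lam ∧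
    ∃ z ∈ pathSimplex lam (Path θ κ o d), (∀ i, y i = flowOf θ κ o d z i) ∧
      ∀ γ, 0 < z γ → ∀ γ', pathCost θ κ o d φ ω y γ ≤ pathCost θ κ o d φ ω y γ'

/-- The local routing split `G_j(z)`. -/
def Gsplit [Fintype E] [DecidableEq V] [DecidableEq E] (θ κ : E → V) (o d : V)
    [Fintype (Path θ κ o d)] (z : Path θ κ o d → ℝ) (j : E) : ℝ :=
  if 0 < ∑ i ∈ Finset.univ.filter (fun i => θ i = θ j), flowOf θ κ o d z i then
    flowOf θ κ o d z j / ∑ i ∈ Finset.univ.filter (fun i => θ i = θ j), flowOf θ κ o d z i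
  else 1 / (Finset.univ.filter (fun i => θ i = θ j)).card

/-- The drift `H_i(y, z)` of the fast-scale traffic dynamics. -/
def drift [Fintype E] [DecidableEq V] [DecidableEq E] (θ κ : E → V) (o d : V)
    [Fintype (Path θ κ o d)] (lam : ℝ) (z : Path θ κ o d → ℝ) (y : E → ℝ) (i : E) : ℝ :=
  Gsplit θ κ o d z i * (lam * (if θ i = o then 1 else 0)
      + ∑ j ∈ Finset.univ.filter (fun j => κ j = θ i), y j) - y i

/-- The set `Z` of feasible path preferences. -/
def Zfeas [Fintype E] [DecidableEq E] (θ κ : E → V) (o d : V)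
    [Fintype (Path θ κ o d)] (φ : E → ℝ → ℝ) (lam : ℝ) : Set (Path θ κ o d → ℝ) :=
  {z ∈ pathSimplex lam (Path θ κ o d) | (fun i => flowOf θ κ o d z i) ∈ feas φ}

/-- The relative interior `Z°` of `Z`. -/
def Zint [Fintype E] [DecidableEq E] (θ κ : E → V) (o d : V)
    [Fintype (Path θ κ o d)] (φ : E → ℝ → ℝ) (lam : ℝ) : Set (Path θ κ o d → ℝ) :=
  {z ∈ Zfeas θ κ o d φ lam | ∀ γ, 0 < z γ}

/-- Euclidean norm of a vector indexed by a finite type. -/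
def euclNorm {α : Type*} [Fintype α] (v : α → ℝ) : ℝ := Real.sqrt (∑ a, v a ^ 2)

/-- The `γ` component of the projected gradient `Φ ∇h(z)` of `h` (derivative taken
within `Zh`), where `Φ = I - |Γ|⁻¹ 𝟙𝟙'`. -/
def projGrad {Γ : Type*} [Fintype Γ] [DecidableEq Γ] (h : (Γ → ℝ) → ℝ)
    (Zh : Set (Γ → ℝ)) (z : Γ → ℝ) (γ : Γ) : ℝ :=
  fderivWithin ℝ h Zh z (fun γ' => (if γ' = γ then (1:ℝ) else 0) - 1 / (Fintype.card Γ : ℝ))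

/-- `h` is an admissible perturbation with domain `Zh ⊆ Zset`: closed convex domain,
strictly convex, twice continuously differentiable on the (intrinsic) interior of its
domain, with projected gradient blowing up at the (intrinsic) boundary. -/
def Admissible {Γ : Type*} [Fintype Γ] [DecidableEq Γ] (Zset Zh : Set (Γ → ℝ))
    (h : (Γ → ℝ) → ℝ) : Prop :=
  Zh ⊆ Zset ∧ IsClosed Zh ∧ Convex ℝ Zh ∧ StrictConvexOn ℝ Zh h ∧
    ContDiffOn ℝ 2 h (intrinsicInterior ℝ Zh) ∧
    ∀ z₀ ∈ intrinsicFrontier ℝ Zh,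
      Tendsto (fun z => euclNorm (projGrad h Zh z))
        (nhdsWithin z₀ (intrinsicInterior ℝ Zh)) atTop

/-- `Fh` is the perturbed best response associated to the admissible perturbation `h`
with domain `Zh`: for all latencies `l` and tolls `w`, `Fh l w` is the unique minimizer
over `Zh` of `α ↦ α' A' (l + w) + h α`. -/
def IsPerturbedBR [Fintype E] [DecidableEq E] (θ κ : E → V) (o d : V)
    [Fintype (Path θ κ o d)] (Zh : Set (Path θ κ o d → ℝ)) (h : (Path θ κ o d → ℝ) → ℝ)
    (Fh : (E → ℝ) → (E → ℝ) → (Path θ κ o d → ℝ)) : Prop :=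
  ∀ l w : E → ℝ, Fh l w ∈ Zh ∧ ∀ α ∈ Zh, α ≠ Fh l w →
    (∑ γ, Fh l w γ * (∑ i, Amat θ κ o d i γ * (l i + w i)) + h (Fh l w)) <
      (∑ γ, α γ * (∑ i, Amat θ κ o d i γ * (l i + w i)) + h α)

/-- A solution of the closed-loop multiscale dynamics with update rate `η`:
locally Lipschitz trajectories `x(t)` (densities) and `z(t)` (path preferences)
with `z(t) ∈ S_λ`, `x(t) ≥ 0`, satisfying `ẋ = H(φ(x), z)` and
`ż = η (Fh(l, w) - z)` for `l_i = τ_i(y_i)`, `w_i = ω_i(y_i)`, `y = φ(x)`. -/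
def IsSolution [Fintype E] [DecidableEq V] [DecidableEq E] (θ κ : E → V) (o d : V)
    [Fintype (Path θ κ o d)] (φ ω : E → ℝ → ℝ) (lam η : ℝ)
    (Fh : (E → ℝ) → (E → ℝ) → (Path θ κ o d → ℝ))
    (x : ℝ → E → ℝ) (z : ℝ → Path θ κ o d → ℝ) : Prop :=
  LocallyLipschitz x ∧ LocallyLipschitz z ∧
    (∀ t ≥ (0:ℝ), z t ∈ pathSimplex lam (Path θ κ o d)) ∧
    (∀ t ≥ (0:ℝ), ∀ i, 0 ≤ x t i) ∧
    (∀ t ≥ (0:ℝ), ∀ i, HasDerivWithinAt (fun s => x s i)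
        (drift θ κ o d lam (z t) (fun j => φ j (x t j)) i) (Set.Ici 0) t) ∧
    (∀ t ≥ (0:ℝ), ∀ γ, HasDerivWithinAt (fun s => z s γ)
        (η * (Fh (fun i => latency (φ i) (φ i (x t i)))
            (fun i => ω i (φ i (x t i))) γ - z t γ)) (Set.Ici 0) t)

/-- The potential `Θ(z) = ∑ i ∫_0^{(Az)_i} (τ_i + ω_i)`. -/
def Theta [Fintype E] [DecidableEq E] (θ κ : E → V) (o d : V)
    [Fintype (Path θ κ o d)] (φ ω : E → ℝ → ℝ) (z : Path θ κ o d → ℝ) : ℝ :=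
  ∑ i, ∫ s in (0:ℝ)..(flowOf θ κ o d z i), (latency (φ i) s + ω i s)

/-- The entropic objective `Θ(z) + β⁻¹ ∑ γ z_γ log z_γ`. -/
def entObj [Fintype E] [DecidableEq E] (θ κ : E → V) (o d : V)
    [Fintype (Path θ κ o d)] (φ ω : E → ℝ → ℝ) (β : ℝ) (z : Path θ κ o d → ℝ) : ℝ :=
  Theta θ κ o d φ ω z + β⁻¹ * ∑ γ, z γ * Real.log (z γ)


/-! ### A scalar comparison principle -/

/-- A function whose right derivative is at most `-b < 0` whenever its value is at least `r`
is eventually at most `r`. -/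
theorem eventually_le_of_right_deriv {W W' : ℝ → ℝ} {T r b : ℝ} (hb : 0 < b)
    (hc : ContinuousOn W (Ici T))
    (hd : ∀ t ≥ T, HasDerivWithinAt W (W' t) (Ici t) t)
    (h : ∀ t ≥ T, r ≤ W t → W' t ≤ -b) : ∀ᶠ t in atTop, W t ≤ r := by
  obtain ⟨t₀, ht₀, hr⟩ : ∃ t ≥ T, W t ≤ r := by
    by_contra! hcon
    have key : ∀ t ≥ T, W t ≤ W T - b * (t - T) := by
      intro t ht
      refine image_le_of_deriv_right_le_deriv_boundary (f := W) (f' := W')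
        (B := fun s => W T - b * (s - T)) (B' := fun _ => -b) (a := T) (b := t)
        (hc.mono Icc_subset_Ici_self) (fun s hs => hd s hs.1) (by simp) (by fun_prop)
        (fun s _ => ?_) (fun s hs => h s hs.1 (hcon s hs.1).le) ⟨ht, le_rfl⟩
      have := (((hasDerivAt_id s).sub_const T).const_mul b).const_sub (W T)
      simpa using this.hasDerivWithinAt
    set t := T + max 0 ((W T - r) / b) with ht
    have h0 : T ≤ t := by simp [ht]
    have h1 := key t h0
    have h2 := hcon t h0
    have h3 : (W T - r) / b ≤ t - T := by simp [ht]
    rw [div_le_iff₀ hb] at h3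
    linarith
  filter_upwards [eventually_ge_atTop t₀] with t ht
  refine image_le_of_deriv_right_lt_deriv_boundary (f := W) (f' := W')
    (B := fun _ => r) (B' := fun _ => 0) (a := t₀) (b := t)
    (hc.mono fun s hs => ht₀.trans hs.1) (fun s hs => hd s (ht₀.trans hs.1)) hr
    (fun s => hasDerivAt_const _ _) (fun s hs he => ?_) ⟨ht, le_rfl⟩
  have := h s (ht₀.trans hs.1) he.ge
  linarith

/-- A solution of `u' ≤ η (e - u)` is eventually below any level `e' > e`. -/
theorem eventually_le_of_deriv_le {u u' : ℝ → ℝ} {T η e e' : ℝ} (hη : 0 < η) (he : e < e')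
    (hT : 0 ≤ T) (hd : ∀ t ≥ T, HasDerivWithinAt u (u' t) (Ici 0) t)
    (h : ∀ t ≥ T, u' t ≤ η * (e - u t)) : ∀ᶠ t in atTop, u t ≤ e' := by
  refine eventually_le_of_right_deriv (W' := u') (T := T) (b := η * (e' - e))
    (mul_pos hη (by linarith)) (fun t ht => ?_) (fun t ht => ?_) (fun t ht hu => ?_)
  · exact (hd t ht).continuousWithinAt.mono (Ici_subset_Ici.2 hT)
  · exact (hd t ht).mono (Ici_subset_Ici.2 (hT.trans ht))
  · have := h t ht
    nlinarith

/-- The right derivative of `|u|` is a subgradient of the absolute value times that of `u`. -/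
theorem hasDerivWithinAt_abs_Ici {u : ℝ → ℝ} {u' t : ℝ} (h : HasDerivWithinAt u u' (Ici t) t) :
    ∃ s : ℝ, |s| ≤ 1 ∧ s * u t = |u t| ∧
      HasDerivWithinAt (fun τ => |u τ|) (s * u') (Ici t) t := by
  rcases lt_trichotomy (u t) 0 with h0 | h0 | h0
  · refine ⟨-1, by simp, by rw [abs_of_neg h0]; ring, ?_⟩
    have := (hasDerivAt_abs_neg h0).comp_hasDerivWithinAt t h
    simpa [Function.comp_def] using this
  · refine ⟨SignType.sign u', ?_, by simp [h0], ?_⟩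
    · rcases lt_trichotomy u' 0 with h1 | h1 | h1 <;> simp [h1]
    · have h1 : (SignType.sign u' : ℝ) * u' = |u'| := by
        rw [mul_comm]; exact self_mul_sign u'
      rw [h1, ← hasDerivWithinAt_Ioi_iff_Ici, hasDerivWithinAt_iff_tendsto_slope' (by simp)]
      rw [← hasDerivWithinAt_Ioi_iff_Ici, hasDerivWithinAt_iff_tendsto_slope' (by simp)] at h
      have h2 := h.abs
      refine h2.congr' ?_
      filter_upwards [self_mem_nhdsWithin] with τ hτ
      have : 0 < τ - t := sub_pos.2 hτ
      simp [slope_def_field, h0, abs_div, abs_of_pos this]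
  · refine ⟨1, by simp, by rw [abs_of_pos h0]; ring, ?_⟩
    have := (hasDerivAt_abs_pos h0).comp_hasDerivWithinAt t h
    simpa [Function.comp_def] using this

/-! ### Flow-density and latency functions -/

namespace Standing

variable {φ : ℝ → ℝ}

theorem continuousOn (h : Standing φ) : ContinuousOn φ (Ici 0) := h.1.continuousOn

theorem lt_iff (h : Standing φ) {a b : ℝ} (ha : 0 ≤ a) (hb : 0 ≤ b) : φ a < φ b ↔ a < b :=
  h.2.1.lt_iff_lt ha hb

theorem le_iff (h : Standing φ) {a b : ℝ} (ha : 0 ≤ a) (hb : 0 ≤ b) : φ a ≤ φ b ↔ a ≤ b :=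
  h.2.1.le_iff_le ha hb

theorem apply_pos (h : Standing φ) {a : ℝ} (ha : 0 < a) : 0 < φ a := by
  have := (h.lt_iff le_rfl ha.le).2 ha
  rwa [h.2.2.2] at this

theorem apply_nonneg (h : Standing φ) {a : ℝ} (ha : 0 ≤ a) : 0 ≤ φ a := by
  have := (h.le_iff le_rfl ha).2 ha
  rwa [h.2.2.2] at this

theorem ofReal_le_cap (φ : ℝ → ℝ) {a : ℝ} (ha : 0 ≤ a) : ENNReal.ofReal (φ a) ≤ cap φ :=
  le_iSup₂_of_le a ha le_rfl

theorem apply_mem_latDom (h : Standing φ) {a : ℝ} (ha : 0 ≤ a) : φ a ∈ latDom φ := by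
  refine ⟨h.apply_nonneg ha, lt_of_lt_of_le ?_ (ofReal_le_cap φ (show 0 ≤ a + 1 by linarith))⟩
  have : φ a < φ (a + 1) := (h.lt_iff ha (by linarith)).2 (by linarith)
  exact (ENNReal.ofReal_lt_ofReal_iff_of_nonneg (h.apply_nonneg ha)).2 this

theorem exists_lt_of_lt_cap {c : ℝ} (hc : ENNReal.ofReal c < cap φ) :
    ∃ X, 0 ≤ X ∧ c < φ X := by
  simp only [cap, lt_iSup_iff] at hc
  obtain ⟨X, hX, hlt⟩ := hc
  exact ⟨X, hX, (ENNReal.ofReal_lt_ofReal_iff'.1 hlt).1⟩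

theorem exists_eq_of_le (h : Standing φ) {y X : ℝ} (hy : 0 ≤ y) (hX : 0 ≤ X) (hle : y ≤ φ X) :
    ∃ x, 0 ≤ x ∧ x ≤ X ∧ φ x = y := by
  obtain ⟨x, hx, rfl⟩ := intermediate_value_Icc hX (h.continuousOn.mono Icc_subset_Ici_self)
    (show y ∈ Icc (φ 0) (φ X) from ⟨by rwa [h.2.2.2], hle⟩)
  exact ⟨x, hx.1, hx.2, rfl⟩

theorem exists_eq_of_mem_latDom (h : Standing φ) {y : ℝ} (hy : y ∈ latDom φ) :
    ∃ x, 0 ≤ x ∧ φ x = y := by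
  obtain ⟨X, hX, hlt⟩ := exists_lt_of_lt_cap hy.2
  obtain ⟨x, hx, -, he⟩ := h.exists_eq_of_le hy.1 hX hlt.le
  exact ⟨x, hx, he⟩

theorem mem_latDom_of_le (h : Standing φ) {y X : ℝ} (hy : 0 ≤ y) (hX : 0 ≤ X) (hle : y ≤ φ X) :
    y ∈ latDom φ := by
  obtain ⟨x, hx, -, rfl⟩ := h.exists_eq_of_le hy hX hle
  exact h.apply_mem_latDom hx

theorem phiInv_apply (h : Standing φ) {x : ℝ} (hx : 0 ≤ x) : phiInv φ (φ x) = x :=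
  h.2.1.injOn.leftInvOn_invFunOn hx

theorem phiInv_mem (h : Standing φ) {y : ℝ} (hy : y ∈ latDom φ) :
    0 ≤ phiInv φ y ∧ φ (phiInv φ y) = y := by
  obtain ⟨x, hx, rfl⟩ := h.exists_eq_of_mem_latDom hy
  rw [h.phiInv_apply hx]
  exact ⟨hx, rfl⟩

theorem phiInv_le (h : Standing φ) {y X : ℝ} (hy : 0 ≤ y) (hX : 0 ≤ X) (hle : y ≤ φ X) :
    phiInv φ y ≤ X := by
  obtain ⟨x, hx, hx', rfl⟩ := h.exists_eq_of_le hy hX hle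
  rwa [h.phiInv_apply hx]

theorem phiInv_pos (h : Standing φ) {y : ℝ} (hy : y ∈ latDom φ) (hpos : 0 < y) :
    0 < phiInv φ y := by
  obtain ⟨h0, h1⟩ := h.phiInv_mem hy
  refine h0.lt_of_ne fun he => ?_
  rw [← he, h.2.2.2] at h1
  exact hpos.ne h1

/-- Increments of `φ` over intervals of a given length decrease with the base point. -/
theorem increment_anti (h : Standing φ) {a X r : ℝ} (ha : 0 ≤ a) (haX : a ≤ X) (hr : 0 < r) :
    φ (X + r) - φ X ≤ φ (a + r) - φ a := by
  have hD : 0 < X + r - a := by linarith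
  have hc := h.2.2.1.concaveOn.2
  have e1 := hc (show a ∈ Ici (0 : ℝ) from ha) (show X + r ∈ Ici (0 : ℝ) from by simp; linarith)
    (show 0 ≤ (X - a) / (X + r - a) from div_nonneg (by linarith) hD.le)
    (show 0 ≤ r / (X + r - a) from div_nonneg hr.le hD.le) (by field_simp; ring)
  have e2 := hc (show a ∈ Ici (0 : ℝ) from ha) (show X + r ∈ Ici (0 : ℝ) from by simp; linarith)
    (show 0 ≤ r / (X + r - a) from div_nonneg hr.le hD.le)
    (show 0 ≤ (X - a) / (X + r - a) from div_nonneg (by linarith) hD.le) (by field_simp; ring)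
  simp only [smul_eq_mul] at e1 e2
  have e3 : (X - a) / (X + r - a) * a + r / (X + r - a) * (X + r) = a + r := by
    field_simp; ring
  have e4 : r / (X + r - a) * a + (X - a) / (X + r - a) * (X + r) = X := by
    field_simp; ring
  have e5 : (X - a) / (X + r - a) + r / (X + r - a) = 1 := by field_simp; ring
  rw [e3] at e1
  rw [e4] at e2
  have : (X - a) / (X + r - a) * φ a + r / (X + r - a) * φ (X + r) +
      (r / (X + r - a) * φ a + (X - a) / (X + r - a) * φ (X + r)) = φ a + φ (X + r) := by
    have e6 : (X - a) / (X + r - a) = 1 - r / (X + r - a) := by linarith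
    rw [e6]; ring
  linarith

/-- A gap of at least `r` between densities gives a uniform gap between flows. -/
theorem gap_le (h : Standing φ) {ξ x X r : ℝ} (hξ : 0 ≤ ξ) (hξX : ξ ≤ X) (hx : 0 ≤ x)
    (hr : 0 < r) (hgap : r ≤ |x - ξ|) : φ (X + r) - φ X ≤ |φ x - φ ξ| := by
  rcases le_total ξ x with hle | hle
  · rw [abs_of_nonneg (by linarith)] at hgap
    have h1 := h.increment_anti hξ hξX hr
    have h2 : φ (ξ + r) ≤ φ x := (h.le_iff (by linarith) hx).2 (by linarith)
    exact le_trans (by linarith) (le_abs_self _)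
  · rw [abs_of_nonpos (by linarith)] at hgap
    have h1 := h.increment_anti (a := ξ - r) (X := X) (by linarith) (by linarith) hr
    have h2 : φ x ≤ φ (ξ - r) := (h.le_iff hx (by linarith)).2 (by linarith)
    rw [sub_add_cancel] at h1
    exact le_trans (by linarith) (neg_le_abs _)

/-- Lower bound on the slope of `φ` on `[0, X]`. -/
theorem slope_ge (h : Standing φ) {a b X : ℝ} (ha : 0 ≤ a) (hab : a < b) (hb : b ≤ X) :
    φ (X + 1) - φ X ≤ (φ b - φ a) / (b - a) := by
  have hc := h.2.2.1.concaveOn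
  have hX : X + 1 ∈ Ici (0 : ℝ) := by simp; linarith
  rcases hb.lt_or_eq with hb | rfl
  · have h1 := hc.slope_anti_adjacent (show b ∈ Ici (0 : ℝ) from by simp; linarith) hX hb
      (lt_add_one X)
    have h2 := hc.slope_anti_adjacent (show a ∈ Ici (0 : ℝ) from ha)
      (show X ∈ Ici (0 : ℝ) from by simp; linarith) hab hb
    simp only [add_sub_cancel_left, div_one] at h1
    linarith
  · have h1 := hc.slope_anti_adjacent (show a ∈ Ici (0 : ℝ) from ha) hX hab (lt_add_one b)
    simpa using h1

theorem slope_pos (h : Standing φ) {X : ℝ} (hX : 0 ≤ X) : 0 < φ (X + 1) - φ X :=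
  sub_pos.2 ((h.lt_iff hX (by linarith)).2 (by linarith))

theorem mul_abs_sub_le (h : Standing φ) {a b X : ℝ} (ha : 0 ≤ a) (hb : 0 ≤ b) (haX : a ≤ X)
    (hbX : b ≤ X) : (φ (X + 1) - φ X) * |a - b| ≤ |φ a - φ b| := by
  wlog hab : a ≤ b generalizing a b
  · rw [abs_sub_comm a, abs_sub_comm (φ a)]
    exact this hb ha hbX haX (le_of_not_ge hab)
  rcases hab.lt_or_eq with hab | rfl
  · have h1 := h.slope_ge ha hab hbX
    rw [le_div_iff₀ (by linarith)] at h1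
    rw [abs_sub_comm a, abs_of_pos (by linarith : 0 < b - a), abs_sub_comm (φ a)]
    exact h1.trans (le_abs_self _)
  · simp

theorem hasDerivAt (h : Standing φ) {x : ℝ} (hx : 0 < x) : HasDerivAt φ (deriv φ x) x := by
  have : DifferentiableAt ℝ φ x :=
    (h.1.differentiableOn (by norm_num) x hx.le).differentiableAt (Ici_mem_nhds hx)
  exact this.hasDerivAt

theorem le_deriv (h : Standing φ) {x X : ℝ} (hx : 0 < x) (hX : x ≤ X) :
    φ (X + 2) - φ (X + 1) ≤ deriv φ x := by
  have h1 := h.2.2.1.concaveOn.slope_le_of_hasDerivAt (x := x) (y := X + 1)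
    (show x ∈ Ici (0 : ℝ) from hx.le) (show X + 1 ∈ Ici (0 : ℝ) from by simp; linarith)
    (by linarith) (h.hasDerivAt hx)
  have h2 := h.slope_ge hx.le (show x < X + 1 by linarith) le_rfl
  rw [slope_def_field] at h1
  rw [show X + 2 = X + 1 + 1 by ring]
  linarith

theorem mem_nhds (h : Standing φ) {y : ℝ} (hy : y ∈ latDom φ) (hpos : 0 < y) :
    latDom φ ∈ 𝓝 y := by
  obtain ⟨X, hX, hlt⟩ := exists_lt_of_lt_cap hy.2
  exact mem_of_superset (Ioo_mem_nhds hpos hlt)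
    fun z hz => h.mem_latDom_of_le hz.1.le hX hz.2.le

theorem continuousOn_phiInv (h : Standing φ) : ContinuousOn (phiInv φ) (latDom φ) := by
  intro y hy
  obtain ⟨x, hx, rfl⟩ := h.exists_eq_of_mem_latDom hy
  have hm := h.slope_pos (show 0 ≤ x + 1 by linarith)
  set m := φ (x + 1 + 1) - φ (x + 1)
  have hlt : φ x < φ (x + 1) := (h.lt_iff hx (by linarith)).2 (by linarith)
  rw [ContinuousWithinAt, tendsto_iff_dist_tendsto_zero]
  have hlim : Tendsto (fun y => |y - φ x| / m) (𝓝[latDom φ] (φ x)) (𝓝 0) := by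
    have : Tendsto (fun y => |y - φ x| / m) (𝓝 (φ x)) (𝓝 (|φ x - φ x| / m)) :=
      Continuous.tendsto (by fun_prop) _
    simpa using this.mono_left nhdsWithin_le_nhds
  refine squeeze_zero' (Eventually.of_forall fun _ => dist_nonneg) ?_ hlim
  filter_upwards [self_mem_nhdsWithin, mem_nhdsWithin_of_mem_nhds (Iio_mem_nhds hlt)] with z hz hz'
  obtain ⟨w, hw, rfl⟩ := h.exists_eq_of_mem_latDom hz
  rw [h.phiInv_apply hw, h.phiInv_apply hx, Real.dist_eq, le_div_iff₀ hm, mul_comm]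
  exact h.mul_abs_sub_le hw hx (((h.lt_iff hw (by linarith)).1 hz').le) (by linarith)

theorem hasDerivAt_phiInv (h : Standing φ) {y : ℝ} (hy : y ∈ latDom φ) (hpos : 0 < y) :
    HasDerivAt (phiInv φ) (deriv φ (phiInv φ y))⁻¹ y := by
  have hn := h.mem_nhds hy hpos
  have hx := h.phiInv_pos hy hpos
  refine HasDerivAt.of_local_left_inverse (h.continuousOn_phiInv.continuousAt hn)
    (h.hasDerivAt hx) ?_ (mem_of_superset hn fun z hz => (h.phiInv_mem hz).2)
  have h1 := h.le_deriv hx le_rfl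
  have h2 := h.slope_pos (show 0 ≤ phiInv φ y + 1 by linarith)
  rw [show phiInv φ y + 1 + 1 = phiInv φ y + 2 by ring] at h2
  exact (h2.trans_le h1).ne'

theorem latency_apply (h : Standing φ) {x : ℝ} (hx : 0 < x) : latency φ (φ x) = x / φ x := by
  rw [latency, if_neg (h.apply_pos hx).ne', h.phiInv_apply hx.le]

theorem latency_zero (φ : ℝ → ℝ) : latency φ 0 = 1 / derivWithin φ (Ici 0) 0 := if_pos rfl

theorem hasDerivWithinAt_zero (h : Standing φ) :
    HasDerivWithinAt φ (derivWithin φ (Ici 0) 0) (Ici 0) 0 :=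
  (h.1.differentiableOn (by norm_num) 0 (by simp)).hasDerivWithinAt

theorem slope_lt_deriv_zero (h : Standing φ) {x : ℝ} (hx : 0 < x) :
    φ x / x < derivWithin φ (Ici 0) 0 := by
  have := h.2.2.1.slope_lt_of_hasDerivWithinAt (x := 0) (y := x) (by simp)
    (show x ∈ Ici (0 : ℝ) from hx.le) hx h.hasDerivWithinAt_zero
  simpa [slope_def_field, h.2.2.2] using this

theorem deriv_zero_pos (h : Standing φ) : 0 < derivWithin φ (Ici 0) 0 :=
  lt_trans (by have := h.apply_pos one_pos; positivity) (h.slope_lt_deriv_zero one_pos)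

theorem latency_strictMonoOn (h : Standing φ) : StrictMonoOn (latency φ) (latDom φ) := by
  intro y hy y' hy' hlt
  obtain ⟨x, hx, rfl⟩ := h.exists_eq_of_mem_latDom hy
  obtain ⟨x', hx', rfl⟩ := h.exists_eq_of_mem_latDom hy'
  have hxx := (h.lt_iff hx hx').1 hlt
  have hx'0 : 0 < x' := hx.trans_lt hxx
  have hφ' := h.apply_pos hx'0
  rw [h.latency_apply hx'0]
  rcases hx.lt_or_eq with hx | rfl
  · have hφ := h.apply_pos hx
    rw [h.latency_apply hx]
    have := h.2.2.1.secant_strict_mono (a := 0) (x := x) (y := x') (by simp)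
      hx.le hx' hx.ne' hx'0.ne' hxx
    simp only [h.2.2.2, sub_zero] at this
    rw [div_lt_div_iff₀ (by positivity) (by positivity)] at this ⊢
    linarith
  · rw [h.2.2.2, latency_zero]
    have h1 := h.slope_lt_deriv_zero hx'0
    have h2 := h.deriv_zero_pos
    rw [div_lt_iff₀ hx'0] at h1
    rw [div_lt_div_iff₀ h2 hφ']
    linarith

theorem latency_continuousOn (h : Standing φ) : ContinuousOn (latency φ) (latDom φ) := by
  have h0 : ContinuousWithinAt (fun x => latency φ (φ x)) (Ici 0) 0 := by
    have h1 := (hasDerivWithinAt_iff_tendsto_slope.1 h.hasDerivWithinAt_zero).inv₀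
      h.deriv_zero_pos.ne'
    have : ContinuousWithinAt (fun x => latency φ (φ x)) (Ici 0 \ {0}) 0 := by
      rw [ContinuousWithinAt, h.2.2.2, latency_zero, one_div]
      refine h1.congr' ?_
      filter_upwards [self_mem_nhdsWithin] with x hx
      have hx0 : 0 < x := lt_of_le_of_ne hx.1 (Ne.symm hx.2)
      rw [h.latency_apply hx0]
      simp [slope_def_field, h.2.2.2]
    rwa [continuousWithinAt_sdiff_self] at this
  intro y hy
  rcases eq_or_lt_of_le hy.1 with rfl | hpos
  · have h2 : ContinuousWithinAt ((fun x => latency φ (φ x)) ∘ phiInv φ) (latDom φ) 0 := by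
      refine ContinuousWithinAt.comp (t := Ici 0) ?_ (h.continuousOn_phiInv 0 hy)
        fun z hz => (h.phiInv_mem hz).1
      have : phiInv φ 0 = 0 := by
        conv_lhs => rw [← h.2.2.2]
        exact h.phiInv_apply le_rfl
      rwa [this]
    exact h2.congr (fun z hz => by simp [(h.phiInv_mem hz).2]) (by simp [(h.phiInv_mem hy).2])
  · have h2 : ContinuousAt (fun y => phiInv φ y / y) y :=
      (h.continuousOn_phiInv.continuousAt (h.mem_nhds hy hpos)).div continuousAt_id hpos.ne'
    refine (h2.congr ?_).continuousWithinAt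
    filter_upwards [lt_mem_nhds hpos] with z hz
    rw [latency, if_neg hz.ne']

theorem latency_nonneg (h : Standing φ) {y : ℝ} (hy : y ∈ latDom φ) : 0 ≤ latency φ y := by
  obtain ⟨x, hx, rfl⟩ := h.exists_eq_of_mem_latDom hy
  rcases hx.lt_or_eq with hx | rfl
  · rw [h.latency_apply hx]
    have := h.apply_pos hx
    positivity
  · rw [h.2.2.2, latency_zero]
    have := h.deriv_zero_pos
    positivity

theorem apply_le_toReal_cap (hcap : cap φ ≠ ⊤) {x : ℝ} (hx : 0 ≤ x) :
    φ x ≤ (cap φ).toReal :=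
  (ENNReal.ofReal_le_iff_le_toReal hcap).1 (ofReal_le_cap φ hx)

/-- The flow is unbounded when the capacity is infinite. -/
theorem exists_ge_of_cap_eq_top (hcap : cap φ = ⊤) (M : ℝ) : ∃ X, 0 ≤ X ∧ M < φ X :=
  exists_lt_of_lt_cap (by simp [hcap])

/-- If the capacity is finite, the latency blows up as the flow approaches the capacity. -/
theorem exists_latency_ge (h : Standing φ) (hcap : cap φ ≠ ⊤) (M : ℝ) :
    ∃ X, 0 < X ∧ ∀ x ≥ X, M ≤ latency φ (φ x) := by
  refine ⟨max 1 (M * (cap φ).toReal), by positivity, fun x hx => ?_⟩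
  have hx0 : 0 < x := lt_of_lt_of_le (by positivity) hx
  rw [h.latency_apply hx0, le_div_iff₀ (h.apply_pos hx0)]
  rcases le_total M 0 with hM | hM
  · exact (mul_nonpos_of_nonpos_of_nonneg hM (h.apply_pos hx0).le).trans hx0.le
  · exact (mul_le_mul_of_nonneg_left (apply_le_toReal_cap hcap hx0.le) hM).trans
      ((le_max_right _ _).trans hx)

end Standing

/-! ### Network flows -/

section Network

variable {V E : Type*} {θ κ : E → V} {o d : V}

theorem map_tail_append (a : E) (l : List E) (hc : List.IsChain (fun a b => κ a = θ b) (a :: l))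
    (hl : ((a :: l).map κ).getLast? = some d) :
    (a :: l).map θ ++ [d] = θ a :: (a :: l).map κ := by
  induction l generalizing a with
  | nil => simp at hl; simp [hl]
  | cons b l ih =>
    rw [List.isChain_cons_cons] at hc
    have := ih b hc.2 (by simpa using hl)
    rw [List.map_cons, List.cons_append, this, List.map_cons (l := b :: l), hc.1]

theorem IsSimplePath.map_eq {p : List E} (hp : IsSimplePath θ κ o d p) :
    p.map θ ++ [d] = o :: p.map κ := by
  obtain ⟨h1, h2, h3, h4, -⟩ := hp
  cases p with
  | nil => exact absurd rfl h1
  | cons a l =>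
    simp only [List.map_cons, List.head?_cons, Option.some.injEq] at h2
    rw [map_tail_append a l h4 h3, h2]

theorem IsSimplePath.nodup {p : List E} (hp : IsSimplePath θ κ o d p) : p.Nodup :=
  (List.nodup_cons.1 hp.2.2.2.2).2.of_map _

theorem IsSimplePath.tail_ne {p : List E} (hp : IsSimplePath θ κ o d p) {i : E} (hi : i ∈ p) :
    θ i ≠ d := by
  have h := hp.2.2.2.2
  rw [← hp.map_eq, List.nodup_append] at h
  exact h.2.2 _ (List.mem_map_of_mem hi) _ (by simp)

variable [Fintype E] [DecidableEq E]

theorem sum_Amat (f : E → ℝ) (γ : Path θ κ o d) :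
    ∑ i, f i * Amat θ κ o d i γ = (γ.1.map f).sum := by
  have : Finset.univ.filter (fun i => i ∈ γ.1) = γ.1.toFinset := by ext i; simp
  simp only [Amat, mul_ite, mul_one, mul_zero]
  rw [← Finset.sum_filter, this, List.sum_toFinset f γ.2.nodup]

omit [Fintype E] in
theorem Amat_nonneg (i : E) (γ : Path θ κ o d) : 0 ≤ Amat θ κ o d i γ := by
  unfold Amat; split_ifs <;> norm_num

omit [Fintype E] in
theorem Amat_le_one (i : E) (γ : Path θ κ o d) : Amat θ κ o d i γ ≤ 1 := by
  unfold Amat; split_ifs <;> norm_num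

variable [Fintype (Path θ κ o d)]

theorem sum_mul_flowOf (z : Path θ κ o d → ℝ) (f : E → ℝ) :
    ∑ i, f i * flowOf θ κ o d z i = ∑ γ, z γ * ∑ i, f i * Amat θ κ o d i γ := by
  simp only [flowOf, Finset.mul_sum]
  rw [Finset.sum_comm]
  exact Finset.sum_congr rfl fun γ _ => Finset.sum_congr rfl fun i _ => by ring

theorem le_flowOf {z : Path θ κ o d → ℝ} (hz : ∀ γ, 0 ≤ z γ) {i : E} {γ : Path θ κ o d}
    (hi : i ∈ γ.1) : z γ ≤ flowOf θ κ o d z i := by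
  have : z γ = Amat θ κ o d i γ * z γ := by simp [Amat, hi]
  rw [this, flowOf]
  exact Finset.single_le_sum (f := fun γ => Amat θ κ o d i γ * z γ)
    (fun γ _ => mul_nonneg (Amat_nonneg i γ) (hz γ)) (Finset.mem_univ γ)

theorem flowOf_nonneg {z : Path θ κ o d → ℝ} (hz : ∀ γ, 0 ≤ z γ) (i : E) :
    0 ≤ flowOf θ κ o d z i :=
  Finset.sum_nonneg fun γ _ => mul_nonneg (Amat_nonneg i γ) (hz γ)

theorem flowOf_le {lam : ℝ} {z : Path θ κ o d → ℝ} (hz : z ∈ pathSimplex lam (Path θ κ o d))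
    (i : E) : flowOf θ κ o d z i ≤ lam := by
  rw [← hz.2]
  exact Finset.sum_le_sum fun γ _ =>
    mul_le_of_le_one_left (hz.1 γ) (Amat_le_one i γ)

theorem flowOf_pos (hcover : ∀ i : E, ∃ γ : Path θ κ o d, i ∈ γ.1) {z : Path θ κ o d → ℝ}
    (hz : ∀ γ, 0 < z γ) (i : E) : 0 < flowOf θ κ o d z i := by
  obtain ⟨γ, hγ⟩ := hcover i
  exact (hz γ).trans_le (le_flowOf (fun γ => (hz γ).le) hγ)

theorem flowOf_sub_flowOf (z z' : Path θ κ o d → ℝ) (i : E) :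
    flowOf θ κ o d z i - flowOf θ κ o d z' i = flowOf θ κ o d (z - z') i := by
  simp [flowOf, ← Finset.sum_sub_distrib, mul_sub]

theorem abs_flowOf_le (z : Path θ κ o d → ℝ) (i : E) :
    |flowOf θ κ o d z i| ≤ ∑ γ, |z γ| := by
  refine (Finset.abs_sum_le_sum_abs _ _).trans (Finset.sum_le_sum fun γ _ => ?_)
  rw [abs_mul, abs_of_nonneg (Amat_nonneg i γ)]
  exact mul_le_of_le_one_left (abs_nonneg _) (Amat_le_one i γ)

theorem continuous_flowOf (i : E) : Continuous fun z => flowOf θ κ o d z i := by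
  unfold flowOf; fun_prop

variable [DecidableEq V]

/-- Conservation of the flow associated to a path preference vector. -/
theorem flowOf_conservation {lam : ℝ} {z : Path θ κ o d → ℝ}
    (hz : z ∈ pathSimplex lam (Path θ κ o d)) (v : V) :
    ∑ i with θ i = v, flowOf θ κ o d z i + lam * (if d = v then 1 else 0) =
      lam * (if o = v then 1 else 0) + ∑ i with κ i = v, flowOf θ κ o d z i := by
  have key : ∀ γ : Path θ κ o d,
      ∑ i, (if θ i = v then (1 : ℝ) else 0) * Amat θ κ o d i γ + (if d = v then 1 else 0) =
      (if o = v then 1 else 0) + ∑ i, (if κ i = v then (1 : ℝ) else 0) * Amat θ κ o d i γ := by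
    intro γ
    have := congrArg (fun l => (l.map fun u => if u = v then (1 : ℝ) else 0).sum) γ.2.map_eq
    simp only [List.map_append, List.sum_append, List.map_cons, List.sum_cons, List.map_nil,
      List.sum_nil, add_zero, List.map_map] at this
    rw [sum_Amat, sum_Amat]
    exact this
  have e : ∀ f : E → V, ∑ i with f i = v, flowOf θ κ o d z i =
      ∑ γ, z γ * ∑ i, (if f i = v then (1 : ℝ) else 0) * Amat θ κ o d i γ := by
    intro f
    rw [← sum_mul_flowOf, Finset.sum_filter]
    simp
  rw [e, e, ← hz.2, Finset.sum_mul, Finset.sum_mul, ← Finset.sum_add_distrib,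
    ← Finset.sum_add_distrib]
  refine Finset.sum_congr rfl fun γ _ => ?_
  rw [← mul_add, ← mul_add, key]

theorem flowOf_mem_eqFlow (hloop : ∀ i, θ i ≠ κ i) {lam : ℝ} {z : Path θ κ o d → ℝ}
    (hz : z ∈ pathSimplex lam (Path θ κ o d)) :
    (fun i => flowOf θ κ o d z i) ∈ eqFlow θ κ o d lam := by
  refine ⟨flowOf_nonneg hz.1, fun v => ?_⟩
  have h := flowOf_conservation hz v
  have e : ∑ i, Bmat θ κ v i * flowOf θ κ o d z i =
      ∑ i with θ i = v, flowOf θ κ o d z i - ∑ i with κ i = v, flowOf θ κ o d z i := by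
    rw [Finset.sum_filter, Finset.sum_filter, ← Finset.sum_sub_distrib]
    refine Finset.sum_congr rfl fun i _ => ?_
    unfold Bmat
    by_cases h1 : θ i = v
    · have : κ i ≠ v := fun h2 => hloop i (h1.trans h2.symm)
      simp [h1, this]
    · by_cases h2 : κ i = v
      · simp [h1, Ne.symm h1, h2]
      · simp [h1, h2, Ne.symm h1, Ne.symm h2]
  rw [e]
  simp only [eq_comm (a := v)]
  linarith

/-! ### Routing splits and the drift -/

theorem Gsplit_nonneg {z : Path θ κ o d → ℝ} (hz : ∀ γ, 0 ≤ z γ) (i : E) :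
    0 ≤ Gsplit θ κ o d z i := by
  unfold Gsplit
  split_ifs with h
  · exact div_nonneg (flowOf_nonneg hz i) h.le
  · positivity

section Positive

variable (hcover : ∀ i : E, ∃ γ : Path θ κ o d, i ∈ γ.1) {lam : ℝ} {z : Path θ κ o d → ℝ}
  (hz : z ∈ pathSimplex lam (Path θ κ o d)) (hpos : ∀ γ, 0 < z γ)

include hcover hpos

theorem sum_flowOf_pos (i : E) : 0 < ∑ j with θ j = θ i, flowOf θ κ o d z j :=
  Finset.sum_pos (fun j _ => flowOf_pos hcover hpos j) ⟨i, by simp⟩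

theorem Gsplit_eq (i : E) : Gsplit θ κ o d z i =
    flowOf θ κ o d z i / ∑ j with θ j = θ i, flowOf θ κ o d z j :=
  if_pos (sum_flowOf_pos hcover hpos i)

theorem sum_Gsplit (i : E) : ∑ j with θ j = θ i, Gsplit θ κ o d z j = 1 := by
  have : ∀ j ∈ Finset.univ.filter (fun j => θ j = θ i), Gsplit θ κ o d z j =
      flowOf θ κ o d z j / ∑ j with θ j = θ i, flowOf θ κ o d z j := by
    intro j hj
    rw [Gsplit_eq hcover hpos, (Finset.mem_filter.1 hj).2]
  rw [Finset.sum_congr rfl this, ← Finset.sum_div, div_self (sum_flowOf_pos hcover hpos i).ne']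

theorem Gsplit_le_one (i : E) : Gsplit θ κ o d z i ≤ 1 := by
  rw [← sum_Gsplit hcover hpos i]
  exact Finset.single_le_sum (f := fun j => Gsplit θ κ o d z j)
    (fun j _ => Gsplit_nonneg (fun γ => (hpos γ).le) j) (by simp)

include hz

theorem Gsplit_ge {m : ℝ} (hlam : 0 < lam) (hm : ∀ γ, m ≤ z γ) (i : E) :
    m / (Fintype.card E * lam) ≤ Gsplit θ κ o d z i := by
  rw [Gsplit_eq hcover hpos]
  obtain ⟨γ, hγ⟩ := hcover i
  have h1 : m ≤ flowOf θ κ o d z i := (hm γ).trans (le_flowOf hz.1 hγ)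
  have h2 : ∑ j with θ j = θ i, flowOf θ κ o d z j ≤ Fintype.card E * lam := by
    refine (Finset.sum_le_univ_sum_of_nonneg (flowOf_nonneg hz.1)).trans ?_
    refine (Finset.sum_le_sum fun j _ => flowOf_le hz j).trans ?_
    simp
  calc m / (Fintype.card E * lam) ≤ flowOf θ κ o d z i / (Fintype.card E * lam) := by
        gcongr
    _ ≤ _ := div_le_div_of_nonneg_left (flowOf_nonneg hz.1 i) (sum_flowOf_pos hcover hpos i) h2

theorem Gsplit_mul_inflow (i : E) :
    Gsplit θ κ o d z i * (lam * (if θ i = o then 1 else 0) +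
      ∑ j with κ j = θ i, flowOf θ κ o d z j) = flowOf θ κ o d z i := by
  obtain ⟨γ, hγ⟩ := hcover i
  have h := flowOf_conservation hz (θ i)
  rw [if_neg (γ.2.tail_ne hγ).symm, mul_zero, add_zero] at h
  rw [Gsplit_eq hcover hpos]
  simp only [eq_comm (a := θ i) (b := o)]
  rw [← h, div_mul_cancel₀ _ (sum_flowOf_pos hcover hpos i).ne']

theorem drift_eq (y : E → ℝ) (i : E) :
    drift θ κ o d lam z y i = Gsplit θ κ o d z i *
      (∑ j with κ j = θ i, (y j - flowOf θ κ o d z j)) - (y i - flowOf θ κ o d z i) := by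
  have h := Gsplit_mul_inflow hcover hz hpos i
  rw [drift, Finset.sum_sub_distrib]
  linear_combination h

end Positive

/-! ### Weights for which the routing matrix is a strict contraction -/

/-- `Reach θ κ d k v`: the node `d` can be reached from `v` along `k` consecutive links. -/
def Reach {V E : Type*} (θ κ : E → V) (d : V) : ℕ → V → Prop
  | 0, v => v = d
  | k + 1, v => ∃ i, θ i = v ∧ Reach θ κ d k (κ i)

omit [Fintype E] [DecidableEq E] [DecidableEq V] [Fintype (Path θ κ o d)] in
theorem exists_reach_of_chain (p : List E) (hc : List.IsChain (fun a b => κ a = θ b) p)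
    (hl : (p.map κ).getLast? = some d) : ∀ j ∈ p, ∃ k, Reach θ κ d k (κ j) := by
  induction p with
  | nil => simp
  | cons a l ih =>
    cases l with
    | nil =>
      intro j hj
      simp at hl hj
      exact ⟨0, by rw [hj, hl, Reach]⟩
    | cons b l =>
      rw [List.isChain_cons_cons] at hc
      have ih' := ih hc.2 (by simpa using hl)
      intro j hj
      rcases List.mem_cons.1 hj with rfl | hj
      · obtain ⟨k, hk⟩ := ih' b (by simp)
        exact ⟨k + 1, b, hc.1.symm, hk⟩
      · exact ih' j hj

/-- There are link weights in `[1, 2]` that decrease in expectation along the routing by a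
uniform amount, for all path preferences bounded away from zero. -/
theorem exists_weights (hcover : ∀ i : E, ∃ γ : Path θ κ o d, i ∈ γ.1) {lam m : ℝ}
    (hlam : 0 < lam) (hm : 0 < m) :
    ∃ (w : E → ℝ) (ε : ℝ), 0 < ε ∧ (∀ i, 1 ≤ w i) ∧ (∀ i, w i ≤ 2) ∧
      ∀ z ∈ pathSimplex lam (Path θ κ o d), (∀ γ, m ≤ z γ) →
        ∀ j, ∑ i with θ i = κ j, w i * Gsplit θ κ o d z i ≤ w j - ε := by
  classical
  have hex : ∀ j : E, ∃ k, Reach θ κ d k (κ j) := fun j => by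
    obtain ⟨γ, hγ⟩ := hcover j
    exact exists_reach_of_chain γ.1 γ.2.2.2.2.1 γ.2.2.2.1 j hγ
  set n : E → ℕ := fun j => Nat.find (hex j) with hn
  set g : ℝ := min 1 (m / (Fintype.card E * lam)) with hg
  rcases isEmpty_or_nonempty E with hE | hE
  · exact ⟨fun _ => 1, 1, one_pos, by simp, by simp, fun _ _ _ j => (hE.false j).elim⟩
  have hg0 : 0 < g := lt_min one_pos (by have := Fintype.card_pos (α := E); positivity)
  have hg1 : g ≤ 1 := min_le_left _ _
  obtain ⟨N, hN⟩ : ∃ N, ∀ j, n j ≤ N :=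
    ⟨Finset.univ.sup n, fun j => Finset.le_sup (Finset.mem_univ j)⟩
  have hpow : ∀ k, (g / 2) ^ k ≤ 1 := fun k => pow_le_one₀ (by positivity) (by linarith)
  refine ⟨fun j => 2 - (g / 2) ^ n j, (g / 2) ^ N, by positivity,
    fun i => by have := hpow (n i); linarith,
    fun i => by have : 0 < (g / 2) ^ n i := by positivity
                linarith, fun z hz hzm j => ?_⟩
  have hpos : ∀ γ, 0 < z γ := fun γ => hm.trans_le (hzm γ)
  have hNj : (g / 2) ^ N ≤ (g / 2) ^ n j :=
    pow_le_pow_of_le_one (by positivity) (by linarith) (hN j)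
  have hspec : Reach θ κ d (n j) (κ j) := Nat.find_spec (hex j)
  rcases hk : n j with _ | k
  · rw [hk] at hspec hNj
    rw [Finset.sum_eq_zero]
    · change 0 ≤ 2 - (g / 2) ^ n j - (g / 2) ^ N
      rw [hk, pow_zero] at *
      linarith
    · intro i hi
      obtain ⟨γ, hγ⟩ := hcover i
      exact absurd ((Finset.mem_filter.1 hi).2.trans hspec) (γ.2.tail_ne hγ)
  · rw [hk] at hspec hNj
    obtain ⟨i₀, hi₀, hr⟩ := hspec
    have hni : n i₀ ≤ k := Nat.find_min' _ hr
    have hsum : ∑ i with θ i = κ j, Gsplit θ κ o d z i = 1 := by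
      rw [← hi₀]; exact sum_Gsplit hcover hpos i₀
    have hG : g ≤ Gsplit θ κ o d z i₀ :=
      (min_le_right _ _).trans (Gsplit_ge hcover hz hpos hlam hzm i₀)
    have h1 : ∑ i with θ i = κ j, (2 - (g / 2) ^ n i) * Gsplit θ κ o d z i =
        2 - ∑ i with θ i = κ j, (g / 2) ^ n i * Gsplit θ κ o d z i := by
      simp only [sub_mul, Finset.sum_sub_distrib, ← Finset.mul_sum, hsum, mul_one]
    have h2 : (g / 2) ^ n i₀ * Gsplit θ κ o d z i₀ ≤
        ∑ i with θ i = κ j, (g / 2) ^ n i * Gsplit θ κ o d z i :=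
      Finset.single_le_sum (f := fun i => (g / 2) ^ n i * Gsplit θ κ o d z i)
        (fun i _ => mul_nonneg (by positivity) (Gsplit_nonneg hz.1 i)) (by simp [hi₀])
    have h3 : (g / 2) ^ k * g ≤ (g / 2) ^ n i₀ * Gsplit θ κ o d z i₀ :=
      mul_le_mul (pow_le_pow_of_le_one (by positivity) (by linarith) hni) hG hg0.le
        (by positivity)
    have h4 : (g / 2) ^ k * g = 2 * (g / 2) ^ (k + 1) := by ring
    change _ ≤ 2 - (g / 2) ^ n j - (g / 2) ^ N
    rw [h1, hk]
    linarith

omit [DecidableEq E] in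
/-- Weighted `ℓ¹` dissipation for a substochastic routing. -/
theorem weighted_dissipation {w G v s : E → ℝ} {ε : ℝ} (hw : ∀ i, 0 ≤ w i) (hG : ∀ i, 0 ≤ G i)
    (h : ∀ j, ∑ i with θ i = κ j, w i * G i ≤ w j - ε) (hs : ∀ i, |s i| ≤ 1)
    (hsv : ∀ i, s i * v i = |v i|) :
    ∑ i, w i * (s i * (G i * (∑ j with κ j = θ i, v j) - v i)) ≤ -(ε * ∑ j, |v j|) := by
  have h1 : ∀ i, w i * (s i * (G i * (∑ j with κ j = θ i, v j) - v i)) ≤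
      w i * G i * (∑ j with κ j = θ i, |v j|) - w i * |v i| := by
    intro i
    have h2 : s i * (∑ j with κ j = θ i, v j) ≤ ∑ j with κ j = θ i, |v j| := by
      refine (le_abs_self _).trans ?_
      rw [abs_mul]
      exact (mul_le_of_le_one_left (abs_nonneg _) (hs i)).trans (Finset.abs_sum_le_sum_abs _ _)
    have h3 := mul_le_mul_of_nonneg_left h2 (mul_nonneg (hw i) (hG i))
    have h4 := hsv i
    calc _ = w i * G i * (s i * (∑ j with κ j = θ i, v j)) - w i * (s i * v i) := by ring
      _ ≤ _ := by rw [h4]; linarith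
  have h5 : ∑ i, w i * G i * (∑ j with κ j = θ i, |v j|) =
      ∑ j, |v j| * ∑ i with θ i = κ j, w i * G i := by
    simp only [Finset.mul_sum, Finset.sum_filter]
    rw [Finset.sum_comm]
    refine Finset.sum_congr rfl fun j _ => Finset.sum_congr rfl fun i _ => ?_
    simp only [eq_comm (a := θ i)]
    split_ifs <;> ring
  calc _ ≤ ∑ i, (w i * G i * (∑ j with κ j = θ i, |v j|) - w i * |v i|) :=
        Finset.sum_le_sum fun i _ => h1 i
    _ = ∑ j, |v j| * (∑ i with θ i = κ j, w i * G i - w j) := by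
        rw [Finset.sum_sub_distrib, h5, ← Finset.sum_sub_distrib]
        exact Finset.sum_congr rfl fun j _ => by ring
    _ ≤ ∑ j, |v j| * (-ε) := Finset.sum_le_sum fun j _ =>
        mul_le_mul_of_nonneg_left (by linarith [h j]) (abs_nonneg _)
    _ = _ := by rw [← Finset.sum_mul]; ring

omit [DecidableEq E] in
/-- Weighted dissipation of the total flow over a set `I` of links. -/
theorem weighted_dissipation_on {w G y b : E → ℝ} {ε lam : ℝ} (I : E → Prop) [DecidablePred I]
    (hw : ∀ i, 0 ≤ w i) (hw2 : ∀ i, w i ≤ 2) (hG : ∀ i, 0 ≤ G i) (hG1 : ∀ i, G i ≤ 1)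
    (hb : ∀ i, b i ≤ lam) (hlam : 0 ≤ lam)
    (h : ∀ j, ∑ i with θ i = κ j, w i * G i ≤ w j - ε) (hy : ∀ i, 0 ≤ y i) :
    ∑ i with I i, w i * (G i * (b i + ∑ j with κ j = θ i, y j) - y i) ≤
      2 * Fintype.card E * (lam + ∑ j with ¬ I j, y j) - ε * ∑ j with I j, y j := by
  have h1 : ∀ i, w i * (G i * (b i + ∑ j with κ j = θ i, y j) - y i) ≤
      2 * (lam + ∑ j with ¬ I j, y j) +
        (w i * G i * ∑ j with I j, (if κ j = θ i then y j else 0)) - w i * y i := by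
    intro i
    have h2 : ∑ j with κ j = θ i, y j ≤
        ∑ j with I j, (if κ j = θ i then y j else 0) + ∑ j with ¬ I j, y j := by
      rw [Finset.sum_filter, ← Finset.sum_filter_add_sum_filter_not Finset.univ I]
      refine add_le_add le_rfl (Finset.sum_le_sum fun j _ => ?_)
      split_ifs
      · exact le_rfl
      · exact hy j
    have h3 : 0 ≤ w i * G i := mul_nonneg (hw i) (hG i)
    have h4 : w i * G i ≤ 2 := by
      have := mul_le_mul (hw2 i) (hG1 i) (hG i) (by norm_num)
      linarith
    have h5 : 0 ≤ ∑ j with ¬ I j, y j := Finset.sum_nonneg fun j _ => hy j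
    have h6 := mul_le_mul_of_nonneg_left (add_le_add (hb i) h2) h3
    have h7 := mul_le_mul_of_nonneg_right h4 (add_nonneg hlam h5)
    nlinarith
  have h0 : 0 ≤ lam + ∑ j with ¬ I j, y j :=
    add_nonneg hlam (Finset.sum_nonneg fun j _ => hy j)
  have h8 : ∑ i with I i, (w i * G i * ∑ j with I j, (if κ j = θ i then y j else 0)) ≤
      ∑ j with I j, y j * ∑ i with θ i = κ j, w i * G i := by
    simp only [Finset.mul_sum]
    rw [Finset.sum_comm]
    refine Finset.sum_le_sum fun j _ => ?_
    rw [Finset.sum_filter (p := fun i => θ i = κ j)]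
    refine (Finset.sum_le_univ_sum_of_nonneg fun i => ?_).trans (Finset.sum_le_sum fun i _ => ?_)
    · split_ifs
      · exact mul_nonneg (mul_nonneg (hw i) (hG i)) (hy j)
      · simp
    · simp only [eq_comm (a := θ i)]
      split_ifs
      · exact (mul_comm _ _).le
      · simp
  have h9 : ∑ j with I j, y j * ∑ i with θ i = κ j, w i * G i ≤
      ∑ j with I j, y j * (w j - ε) :=
    Finset.sum_le_sum fun j _ => mul_le_mul_of_nonneg_left (h j) (hy j)
  have h10 : ∑ j with I j, y j * (w j - ε) =
      ∑ j with I j, w j * y j - ε * ∑ j with I j, y j := by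
    rw [Finset.mul_sum, ← Finset.sum_sub_distrib]
    exact Finset.sum_congr rfl fun j _ => by ring
  have h11 : ∑ i with I i, 2 * (lam + ∑ j with ¬ I j, y j) ≤
      2 * Fintype.card E * (lam + ∑ j with ¬ I j, y j) := by
    rw [Finset.sum_const, nsmul_eq_mul]
    have : ((Finset.univ.filter I).card : ℝ) ≤ Fintype.card E := by
      exact_mod_cast Finset.card_le_univ _
    nlinarith
  calc _ ≤ ∑ i with I i, (2 * (lam + ∑ j with ¬ I j, y j) +
        (w i * G i * ∑ j with I j, (if κ j = θ i then y j else 0)) - w i * y i) :=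
        Finset.sum_le_sum fun i _ => h1 i
    _ = ∑ i with I i, 2 * (lam + ∑ j with ¬ I j, y j) +
        ∑ i with I i, (w i * G i * ∑ j with I j, (if κ j = θ i then y j else 0)) -
        ∑ i with I i, w i * y i := by
        rw [Finset.sum_sub_distrib, Finset.sum_add_distrib]
    _ ≤ _ := by linarith

end Network

/-! ### Costs, potential and entropy -/

/-- Perceived cost of a link at a given flow. -/
def linkCost {E : Type*} (φ ω : E → ℝ → ℝ) (i : E) (y : ℝ) : ℝ := latency (φ i) y + ω i y

section Cost

variable {E : Type*} [Fintype E] {φ ω : E → ℝ → ℝ} (hφ : ∀ i, Standing (φ i))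

include hφ

theorem linkCost_continuousOn (hlip : LipschitzPolicy φ ω) (i : E) :
    ContinuousOn (linkCost φ ω i) (latDom (φ i)) := by
  obtain ⟨K, hK⟩ := hlip i
  exact (hφ i).latency_continuousOn.add hK.continuousOn

theorem linkCost_strictMonoOn (hmon : MonotonePolicy φ ω) (i : E) :
    StrictMonoOn (linkCost φ ω i) (latDom (φ i)) :=
  (hφ i).latency_strictMonoOn.add_monotone (hmon i).1

omit hφ in
theorem latency_le_linkCost (hmon : MonotonePolicy φ ω) (i : E) {y : ℝ}
    (hy : y ∈ latDom (φ i)) : latency (φ i) y ≤ linkCost φ ω i y :=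
  le_add_of_nonneg_right ((hmon i).2 y hy)

theorem linkCost_nonneg (hmon : MonotonePolicy φ ω) (i : E) {y : ℝ}
    (hy : y ∈ latDom (φ i)) : 0 ≤ linkCost φ ω i y :=
  ((hφ i).latency_nonneg hy).trans (latency_le_linkCost hmon i hy)

theorem hasDerivAt_integral_linkCost (hlip : LipschitzPolicy φ ω) (i : E) {y : ℝ}
    (hy : y ∈ latDom (φ i)) (hpos : 0 < y) :
    HasDerivAt (fun u => ∫ s in (0:ℝ)..u, (latency (φ i) s + ω i s)) (linkCost φ ω i y) y := by
  have hc := linkCost_continuousOn hφ hlip i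
  obtain ⟨X, hX, hlt⟩ := Standing.exists_lt_of_lt_cap hy.2
  have hsub : Ioo 0 (φ i X) ⊆ latDom (φ i) :=
    fun z hz => (hφ i).mem_latDom_of_le hz.1.le hX hz.2.le
  refine intervalIntegral.integral_hasDerivAt_right (f := linkCost φ ω i) ?_ ?_ ?_
  · refine (hc.mono fun z hz => ?_).intervalIntegrable
    rw [uIcc_of_le hpos.le] at hz
    exact (hφ i).mem_latDom_of_le hz.1 hX (hz.2.trans hlt.le)
  · exact ContinuousOn.stronglyMeasurableAtFilter isOpen_Ioo (hc.mono hsub) y ⟨hpos, hlt⟩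
  · exact hc.continuousAt ((hφ i).mem_nhds hy hpos)

theorem integral_linkCost_sub_ge (hmon : MonotonePolicy φ ω) (hlip : LipschitzPolicy φ ω)
    (i : E) {a b : ℝ} (ha : a ∈ latDom (φ i)) (ha0 : 0 < a) (hb : b ∈ latDom (φ i))
    (hb0 : 0 < b) :
    linkCost φ ω i a * (b - a) ≤ (∫ s in (0:ℝ)..b, (latency (φ i) s + ω i s)) -
      ∫ s in (0:ℝ)..a, (latency (φ i) s + ω i s) := by
  have hm := (linkCost_strictMonoOn hφ hmon i).monotoneOn
  have hmem : ∀ {u v w : ℝ}, 0 < u → u ≤ v → v ≤ w → w ∈ latDom (φ i) → v ∈ latDom (φ i) :=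
    fun hu huv hvw hw => ⟨(hu.trans_le huv).le, (ENNReal.ofReal_le_ofReal hvw).trans_lt hw.2⟩
  have hd : ∀ {u v : ℝ}, 0 < u → v ∈ latDom (φ i) → ∀ x ∈ Icc u v,
      HasDerivAt (fun u => ∫ s in (0:ℝ)..u, (latency (φ i) s + ω i s)) (linkCost φ ω i x) x :=
    fun hu hv x hx =>
      hasDerivAt_integral_linkCost hφ hlip i (hmem hu hx.1 hx.2 hv) (hu.trans_le hx.1)
  rcases lt_trichotomy a b with hab | rfl | hab
  · obtain ⟨c, hc, he⟩ := exists_hasDerivAt_eq_slope _ _ hab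
      (fun x hx => (hd ha0 hb x hx).continuousAt.continuousWithinAt)
      (fun x hx => hd ha0 hb x (Ioo_subset_Icc_self hx))
    rw [eq_div_iff (by linarith)] at he
    rw [← he]
    exact mul_le_mul_of_nonneg_right (hm ha (hmem ha0 hc.1.le hc.2.le hb) hc.1.le) (by linarith)
  · simp
  · obtain ⟨c, hc, he⟩ := exists_hasDerivAt_eq_slope _ _ hab
      (fun x hx => (hd hb0 ha x hx).continuousAt.continuousWithinAt)
      (fun x hx => hd hb0 ha x (Ioo_subset_Icc_self hx))
    rw [eq_div_iff (by linarith)] at he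
    have := mul_le_mul_of_nonneg_right (hm (hmem hb0 hc.1.le hc.2.le ha) ha hc.2.le)
      (show 0 ≤ a - b by linarith)
    linarith

end Cost

/-- Strong convexity of `x ↦ x log x` on `(0, lam]`. -/
theorem mul_log_strong_convex {a b lam : ℝ} (ha : 0 < a) (hb : 0 < b) (hal : a ≤ lam)
    (hbl : b ≤ lam) :
    (Real.log b + 1) * (a - b) + (a - b) ^ 2 / (4 * lam) ≤
      a * Real.log a - b * Real.log b := by
  set p := Real.sqrt a with hp
  set q := Real.sqrt b with hq
  have hp0 : 0 < p := Real.sqrt_pos.2 ha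
  have hq0 : 0 < q := Real.sqrt_pos.2 hb
  have ea : a = p ^ 2 := (Real.sq_sqrt ha.le).symm
  have eb : b = q ^ 2 := (Real.sq_sqrt hb.le).symm
  have h1 := Real.log_le_sub_one_of_pos (div_pos hq0 hp0)
  rw [Real.log_div hq0.ne' hp0.ne'] at h1
  have la : Real.log a = 2 * Real.log p := by rw [ea, Real.log_pow]; norm_num
  have lb : Real.log b = 2 * Real.log q := by rw [eb, Real.log_pow]; norm_num
  have h2 : p ^ 2 * (Real.log q - Real.log p) ≤ p * q - p ^ 2 := by
    have := mul_le_mul_of_nonneg_left h1 (sq_nonneg p)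
    have e : p ^ 2 * (q / p - 1) = p * q - p ^ 2 := by field_simp
    linarith
  have h3 : (a - b) ^ 2 / (4 * lam) ≤ (p - q) ^ 2 := by
    rw [div_le_iff₀ (by linarith)]
    have e : (a - b) ^ 2 = (p - q) ^ 2 * (p + q) ^ 2 := by rw [ea, eb]; ring
    rw [e]
    refine mul_le_mul_of_nonneg_left ?_ (sq_nonneg _)
    nlinarith [sq_nonneg (p - q)]
  rw [la, lb]
  rw [ea, eb] at *
  nlinarith

section Potential

variable {V E : Type*} {θ κ : E → V} {o d : V} [Fintype E] [DecidableEq E]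
  [Fintype (Path θ κ o d)] {φ ω : E → ℝ → ℝ} {lam β : ℝ}

/-- Directional derivative at `z`, along `v`, of the entropic objective. -/
def gradEnt (θ κ : E → V) (o d : V) [Fintype (Path θ κ o d)] (φ ω : E → ℝ → ℝ) (β : ℝ)
    (z v : Path θ κ o d → ℝ) : ℝ :=
  ∑ i, linkCost φ ω i (flowOf θ κ o d z i) * flowOf θ κ o d v i +
    β⁻¹ * ∑ γ, (Real.log (z γ) + 1) * v γ

theorem entObj_hasDerivWithinAt (hcover : ∀ i : E, ∃ γ : Path θ κ o d, i ∈ γ.1)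
    (hφ : ∀ i, Standing (φ i)) (hlip : LipschitzPolicy φ ω) {z : ℝ → Path θ κ o d → ℝ}
    {z' : Path θ κ o d → ℝ} {s : Set ℝ} {t : ℝ} (hz : z t ∈ Zint θ κ o d φ lam)
    (hd : ∀ γ, HasDerivWithinAt (fun τ => z τ γ) (z' γ) s t) :
    HasDerivWithinAt (fun τ => entObj θ κ o d φ ω β (z τ)) (gradEnt θ κ o d φ ω β (z t) z')
      s t := by
  refine HasDerivWithinAt.add ?_ (HasDerivWithinAt.const_mul _ ?_)
  · refine HasDerivWithinAt.fun_sum fun i _ => ?_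
    have h1 : HasDerivWithinAt (fun τ => flowOf θ κ o d (z τ) i) (flowOf θ κ o d z' i) s t :=
      HasDerivWithinAt.fun_sum fun γ _ => (hd γ).const_mul _
    exact (hasDerivAt_integral_linkCost hφ hlip i (hz.1.2 i)
      (flowOf_pos hcover hz.2 i)).comp_hasDerivWithinAt t h1
  · exact HasDerivWithinAt.fun_sum fun γ _ =>
      HasDerivAt.comp_hasDerivWithinAt (h₂ := fun x : ℝ => x * Real.log x) t
        (Real.hasDerivAt_mul_log (hz.2 γ).ne') (hd γ)

theorem Theta_sub_ge (hcover : ∀ i : E, ∃ γ : Path θ κ o d, i ∈ γ.1)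
    (hφ : ∀ i, Standing (φ i)) (hmon : MonotonePolicy φ ω) (hlip : LipschitzPolicy φ ω)
    {z z' : Path θ κ o d → ℝ} (hz : z ∈ Zint θ κ o d φ lam) (hz' : z' ∈ Zint θ κ o d φ lam) :
    ∑ i, linkCost φ ω i (flowOf θ κ o d z i) * flowOf θ κ o d (z' - z) i ≤
      Theta θ κ o d φ ω z' - Theta θ κ o d φ ω z := by
  rw [Theta, Theta, ← Finset.sum_sub_distrib]
  refine Finset.sum_le_sum fun i _ => ?_
  rw [← flowOf_sub_flowOf]
  exact integral_linkCost_sub_ge hφ hmon hlip i (hz.1.2 i) (flowOf_pos hcover hz.2 i)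
    (hz'.1.2 i) (flowOf_pos hcover hz'.2 i)

theorem le_of_mem_pathSimplex {Γ : Type*} [Fintype Γ] {z : Γ → ℝ} (hz : z ∈ pathSimplex lam Γ)
    (γ : Γ) : z γ ≤ lam := by
  rw [← hz.2]
  exact Finset.single_le_sum (f := z) (fun γ _ => hz.1 γ) (Finset.mem_univ γ)

theorem entropy_sub_ge {z z' : Path θ κ o d → ℝ} (hz : z ∈ Zint θ κ o d φ lam)
    (hz' : z' ∈ Zint θ κ o d φ lam) :
    ∑ γ, (Real.log (z γ) + 1) * (z' - z) γ + (∑ γ, (z' γ - z γ) ^ 2) / (4 * lam) ≤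
      ∑ γ, z' γ * Real.log (z' γ) - ∑ γ, z γ * Real.log (z γ) := by
  rw [← Finset.sum_sub_distrib, Finset.sum_div, ← Finset.sum_add_distrib]
  exact Finset.sum_le_sum fun γ _ => mul_log_strong_convex (hz'.2 γ) (hz.2 γ)
    (le_of_mem_pathSimplex hz'.1.1 γ) (le_of_mem_pathSimplex hz.1.1 γ)

theorem entropy_sub_ge' (hlam : 0 < lam) {z z' : Path θ κ o d → ℝ}
    (hz : z ∈ Zint θ κ o d φ lam) (hz' : z' ∈ Zint θ κ o d φ lam) :
    ∑ γ, (Real.log (z γ) + 1) * (z' - z) γ ≤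
      ∑ γ, z' γ * Real.log (z' γ) - ∑ γ, z γ * Real.log (z γ) := by
  have h1 := entropy_sub_ge hz hz'
  have h2 : 0 ≤ (∑ γ, (z' γ - z γ) ^ 2) / (4 * lam) :=
    div_nonneg (Finset.sum_nonneg fun γ _ => sq_nonneg _) (by linarith)
  linarith

/-- Strong convexity of the entropic objective. -/
theorem entObj_sub_ge (hcover : ∀ i : E, ∃ γ : Path θ κ o d, i ∈ γ.1)
    (hφ : ∀ i, Standing (φ i)) (hmon : MonotonePolicy φ ω) (hlip : LipschitzPolicy φ ω)
    (hβ : 0 < β) {z z' : Path θ κ o d → ℝ} (hz : z ∈ Zint θ κ o d φ lam)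
    (hz' : z' ∈ Zint θ κ o d φ lam) :
    gradEnt θ κ o d φ ω β z (z' - z) + β⁻¹ * ((∑ γ, (z' γ - z γ) ^ 2) / (4 * lam)) ≤
      entObj θ κ o d φ ω β z' - entObj θ κ o d φ ω β z := by
  have h1 := Theta_sub_ge hcover hφ hmon hlip hz hz'
  have h2 := mul_le_mul_of_nonneg_left (entropy_sub_ge hz hz') (inv_pos.2 hβ).le
  unfold gradEnt entObj
  linarith

/-- The entropic objective has a minimizer on a compact convex set of positive path
preferences, where a variational inequality holds. -/
theorem exists_minimizer (hcover : ∀ i : E, ∃ γ : Path θ κ o d, i ∈ γ.1)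
    (hφ : ∀ i, Standing (φ i)) (hlip : LipschitzPolicy φ ω) {K : Set (Path θ κ o d → ℝ)}
    (hne : K.Nonempty) (hK : IsCompact K) (hconv : Convex ℝ K) (hsub : K ⊆ Zint θ κ o d φ lam) :
    ∃ zs ∈ K, ∀ α ∈ K, 0 ≤ gradEnt θ κ o d φ ω β zs (α - zs) := by
  have hcont : ContinuousOn (entObj θ κ o d φ ω β) K := by
    refine ContinuousOn.add (continuousOn_finsetSum _ fun i _ => ?_)
      (Continuous.continuousOn ?_)
    · intro z hz
      exact ((hasDerivAt_integral_linkCost hφ hlip i ((hsub hz).1.2 i)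
        (flowOf_pos hcover (hsub hz).2 i)).continuousAt.comp
          (f := fun z => flowOf θ κ o d z i) (continuous_flowOf i).continuousAt).continuousWithinAt
    · exact continuous_const.mul (continuous_finsetSum _ fun γ _ =>
        Real.continuous_mul_log.comp (continuous_apply γ))
  obtain ⟨zs, hzs, hmin⟩ := hK.exists_isMinOn hne hcont
  refine ⟨zs, hzs, fun α hα => ?_⟩
  have hd := entObj_hasDerivWithinAt (β := β) (lam := lam) hcover hφ hlip
    (z := fun τ => zs + τ • (α - zs)) (z' := α - zs) (s := Ioi 0) (t := 0)
    (by simpa using hsub hzs) (fun γ => by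
      have := ((hasDerivWithinAt_id (0 : ℝ) (Ioi 0)).mul_const ((α - zs) γ)).const_add (zs γ)
      simpa using this)
  simp only [zero_smul, add_zero] at hd
  rw [hasDerivWithinAt_iff_tendsto_slope' (by simp)] at hd
  refine ge_of_tendsto hd ?_
  filter_upwards [Ioo_mem_nhdsGT (show (0 : ℝ) < 1 by norm_num)] with τ hτ
  rw [slope_def_field]
  have hmem : zs + τ • (α - zs) ∈ K := by
    have := hconv hzs hα (show 0 ≤ 1 - τ by linarith [hτ.2]) hτ.1.le (by ring)
    convert this using 1
    module
  have := hmin hmem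
  simp only [mem_ofPred_eq] at this
  refine div_nonneg ?_ (by linarith [hτ.1])
  simpa using this

/-- Along the perturbed best response to approximate costs, the entropic objective decreases
proportionally to its excess over the minimum. -/
theorem gradEnt_bestResponse_le (hcover : ∀ i : E, ∃ γ : Path θ κ o d, i ∈ γ.1)
    (hφ : ∀ i, Standing (φ i)) (hmon : MonotonePolicy φ ω) (hlip : LipschitzPolicy φ ω)
    (hlam : 0 < lam) (hβ : 0 < β) {z zs F : Path θ κ o d → ℝ} {k : E → ℝ} {e : ℝ}
    (hz : z ∈ Zint θ κ o d φ lam) (hzs : zs ∈ Zint θ κ o d φ lam) (hF : F ∈ Zint θ κ o d φ lam)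
    (hopt : ∑ γ, F γ * (∑ i, Amat θ κ o d i γ * k i) + β⁻¹ * ∑ γ, F γ * Real.log (F γ) ≤
      ∑ γ, zs γ * (∑ i, Amat θ κ o d i γ * k i) + β⁻¹ * ∑ γ, zs γ * Real.log (zs γ))
    (he : ∀ i, |linkCost φ ω i (flowOf θ κ o d z i) - k i| ≤ e) :
    gradEnt θ κ o d φ ω β z (F - z) ≤
      entObj θ κ o d φ ω β zs + Fintype.card E * (e * lam) - entObj θ κ o d φ ω β z := by
  have h1 := Theta_sub_ge hcover hφ hmon hlip hz hzs
  have h2 := mul_le_mul_of_nonneg_left (entropy_sub_ge' hlam hz hF) (inv_pos.2 hβ).le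
  have e1 : ∀ u : Path θ κ o d → ℝ, ∑ γ, u γ * (∑ i, Amat θ κ o d i γ * k i) =
      ∑ i, k i * flowOf θ κ o d u i := fun u => by
    rw [sum_mul_flowOf]
    simp only [mul_comm]
  rw [e1, e1] at hopt
  have h3 : ∑ i, (linkCost φ ω i (flowOf θ κ o d z i) - k i) *
      (flowOf θ κ o d F i - flowOf θ κ o d zs i) ≤ Fintype.card E * (e * lam) := by
    have : ∀ i ∈ Finset.univ, (linkCost φ ω i (flowOf θ κ o d z i) - k i) *
      (flowOf θ κ o d F i - flowOf θ κ o d zs i) ≤ e * lam := by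
      intro i _
      have a1 := flowOf_nonneg hF.1.1.1 i
      have a2 := flowOf_nonneg hzs.1.1.1 i
      have a3 := flowOf_le hF.1.1 i
      have a4 := flowOf_le hzs.1.1 i
      refine (le_abs_self _).trans ?_
      rw [abs_mul]
      exact mul_le_mul (he i) (abs_le.2 ⟨by linarith, by linarith⟩) (abs_nonneg _)
        ((abs_nonneg _).trans (he i))
    refine (Finset.sum_le_sum this).trans ?_
    simp
  have e2 : ∑ i, linkCost φ ω i (flowOf θ κ o d z i) * flowOf θ κ o d (F - z) i =
      ∑ i, linkCost φ ω i (flowOf θ κ o d z i) * flowOf θ κ o d (zs - z) i +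
      ∑ i, (linkCost φ ω i (flowOf θ κ o d z i) - k i) *
        (flowOf θ κ o d F i - flowOf θ κ o d zs i) +
      (∑ i, k i * flowOf θ κ o d F i - ∑ i, k i * flowOf θ κ o d zs i) := by
    rw [← Finset.sum_sub_distrib, ← Finset.sum_add_distrib, ← Finset.sum_add_distrib]
    refine Finset.sum_congr rfl fun i _ => ?_
    rw [← flowOf_sub_flowOf, ← flowOf_sub_flowOf]
    ring
  unfold gradEnt entObj
  rw [e2]
  linarith

end Potential

/-! ### Convergence of the closed-loop dynamics -/

theorem exists_pos_forall_le {ι : Type*} [Finite ι] {g : ι → ℝ} (h : ∀ i, 0 < g i) :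
    ∃ a > 0, ∀ i, a ≤ g i := by
  cases isEmpty_or_nonempty ι
  · exact ⟨1, one_pos, isEmptyElim⟩
  · obtain ⟨i, hi⟩ := Finite.exists_min g
    exact ⟨g i, h i, hi⟩

theorem exists_phi_linkCost_modulus {E : Type*} [Fintype E] {φ ω : E → ℝ → ℝ}
    (hφ : ∀ i, Standing (φ i)) (hlip : LipschitzPolicy φ ω) {X : E → ℝ} {e : ℝ} (he : 0 < e) :
    ∃ r > 0, ∀ i x ξ, 0 ≤ x → 0 ≤ ξ → ξ ≤ X i → |x - ξ| ≤ r →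
      |φ i x - φ i ξ| ≤ e ∧ |linkCost φ ω i (φ i ξ) - linkCost φ ω i (φ i x)| ≤ e := by
  have key : ∀ i, ∃ r > 0, ∀ x ξ, 0 ≤ x → 0 ≤ ξ → ξ ≤ X i → |x - ξ| ≤ r →
      |φ i x - φ i ξ| ≤ e ∧ |linkCost φ ω i (φ i ξ) - linkCost φ ω i (φ i x)| ≤ e := by
    intro i
    have hc : ContinuousOn (fun x => (φ i x, linkCost φ ω i (φ i x))) (Icc 0 (X i + 1)) := by
      have h1 : ContinuousOn (φ i) (Icc 0 (X i + 1)) :=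
        (hφ i).continuousOn.mono Icc_subset_Ici_self
      exact h1.prodMk ((linkCost_continuousOn hφ hlip i).comp h1
        fun x hx => (hφ i).apply_mem_latDom hx.1)
    have hu := isCompact_Icc.uniformContinuousOn_of_continuous hc
    obtain ⟨r, hr, h⟩ := Metric.uniformContinuousOn_iff_le.1 hu e he
    refine ⟨min r 1, lt_min hr one_pos, fun x ξ hx hξ hξX hd => ?_⟩
    have h1 := (abs_le.1 (hd.trans (min_le_right _ _))).2
    have := h x ⟨hx, by linarith⟩ ξ ⟨hξ, by linarith⟩ (hd.trans (min_le_left _ _))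
    rw [Prod.dist_eq, max_le_iff, Real.dist_eq, Real.dist_eq] at this
    exact ⟨this.1, by rw [abs_sub_comm]; exact this.2⟩
  choose r hr h using key
  obtain ⟨a, ha, har⟩ := exists_pos_forall_le hr
  exact ⟨a, ha, fun i x ξ hx hξ hξX hd => h i x ξ hx hξ hξX (hd.trans (har i))⟩

section Dynamics

variable {V E : Type*} {θ κ : E → V} {o d : V} [Fintype E] [DecidableEq V] [DecidableEq E]
  [Fintype (Path θ κ o d)] {φ ω : E → ℝ → ℝ} {lam η m : ℝ} {X c : E → ℝ}
  {F : (E → ℝ) → (E → ℝ) → Path θ κ o d → ℝ} {x : ℝ → E → ℝ} {z : ℝ → Path θ κ o d → ℝ}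
  {K : Set (Path θ κ o d → ℝ)}

/-- The best response along a trajectory. -/
def response (φ ω : E → ℝ → ℝ) (F : (E → ℝ) → (E → ℝ) → Path θ κ o d → ℝ) (x : E → ℝ) :
    Path θ κ o d → ℝ :=
  F (fun i => latency (φ i) (φ i (x i))) (fun i => ω i (φ i (x i)))

theorem IsSolution.hasDerivWithinAt_flowOf (hsol : IsSolution θ κ o d φ ω lam η F x z) {t : ℝ}
    (ht : 0 ≤ t) (i : E) :
    HasDerivWithinAt (fun τ => flowOf θ κ o d (z τ) i)
      (η * (flowOf θ κ o d (response φ ω F (x t)) i - flowOf θ κ o d (z t) i)) (Ici 0) t := by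
  have h : HasDerivWithinAt (fun τ => flowOf θ κ o d (z τ) i) _ (Ici 0) t :=
    HasDerivWithinAt.fun_sum fun γ _ =>
      (hsol.2.2.2.2.2 t ht γ).const_mul (Amat θ κ o d i γ)
  convert h using 1
  rw [flowOf, flowOf, ← Finset.sum_sub_distrib, Finset.mul_sum]
  exact Finset.sum_congr rfl fun γ _ => by unfold response; ring

/-- The path preferences eventually enter any neighborhood of the range of the best response. -/
theorem IsSolution.eventually_mem (hsol : IsSolution θ κ o d φ ω lam η F x z) (hη : 0 < η)
    (hF : ∀ l w, F l w ∈ K) (hm : 0 < m) (hKm : ∀ z ∈ K, ∀ γ, m ≤ z γ)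
    (hKc : ∀ z ∈ K, ∀ i, flowOf θ κ o d z i ≤ c i) (hX : ∀ i, c i < φ i (X i)) :
    ∀ᶠ t in atTop, (∀ γ, m / 2 ≤ z t γ) ∧ ∀ i, flowOf θ κ o d (z t) i ≤ φ i (X i) := by
  refine (eventually_all.2 fun γ => ?_).and (eventually_all.2 fun i => ?_)
  · have := eventually_le_of_deriv_le hη (show -m < -(m / 2) by linarith) le_rfl
      (fun t ht => (hsol.2.2.2.2.2 t ht γ).neg) (fun t ht => by
        have := mul_le_mul_of_nonneg_left (hKm _ (hF (fun i => latency (φ i) (φ i (x t i)))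
            (fun i => ω i (φ i (x t i)))) γ) hη.le
        simp only [Pi.neg_apply]
        linarith)
    filter_upwards [this] with t ht
    exact neg_le_neg_iff.1 ht
  · exact eventually_le_of_deriv_le hη (hX i) le_rfl
      (fun t ht => hsol.hasDerivWithinAt_flowOf ht i) (fun t ht =>
        mul_le_mul_of_nonneg_left (sub_le_sub_right (hKc _ (hF _ _) i) _) hη.le)

omit [DecidableEq V] in
theorem mem_Zint_of_le (hφ : ∀ i, Standing (φ i)) (hm : 0 < m) (hX : ∀ i, 0 ≤ X i)
    {z : Path θ κ o d → ℝ} (hz : z ∈ pathSimplex lam (Path θ κ o d)) (hzm : ∀ γ, m ≤ z γ)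
    (hzX : ∀ i, flowOf θ κ o d z i ≤ φ i (X i)) : z ∈ Zint θ κ o d φ lam :=
  ⟨⟨hz, fun i => (hφ i).mem_latDom_of_le (flowOf_nonneg hz.1 i) (hX i) (hzX i)⟩,
    fun γ => hm.trans_le (hzm γ)⟩

/-- For slow enough path-preference updates, the densities eventually track those of the
flow induced by the current path preferences. -/
theorem exists_rate_density_tracking (hcover : ∀ i : E, ∃ γ : Path θ κ o d, i ∈ γ.1)
    (hφ : ∀ i, Standing (φ i)) (hlam : 0 < lam) (hm : 0 < m) (hX : ∀ i, 0 ≤ X i)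
    (hF : ∀ l w, F l w ∈ pathSimplex lam (Path θ κ o d)) {r : ℝ} (hr : 0 < r) :
    ∃ η₀ > 0, ∀ η, 0 < η → η ≤ η₀ → ∀ x z, IsSolution θ κ o d φ ω lam η F x z →
      (∀ᶠ t in atTop, (∀ γ, m ≤ z t γ) ∧ ∀ i, flowOf θ κ o d (z t) i ≤ φ i (X i)) →
      ∀ᶠ t in atTop, ∀ i, |x t i - phiInv (φ i) (flowOf θ κ o d (z t) i)| ≤ r := by
  obtain ⟨w, ε, hε, hw1, hw2, hw⟩ := exists_weights (θ := θ) (κ := κ) hcover hlam hm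
  set n : ℝ := (Fintype.card E : ℝ) with hn
  have hn0 : 0 ≤ n := by positivity
  set ρ : ℝ := r / (2 * (n + 1)) with hρ
  have hρ0 : 0 < ρ := by positivity
  obtain ⟨a, ha, hgap⟩ := exists_pos_forall_le (g := fun i => φ i (X i + ρ) - φ i (X i))
    fun i => sub_pos.2 (((hφ i).lt_iff (hX i) (by linarith [hX i])).2 (by linarith))
  have hD0 : ∀ i, 0 < φ i (X i + 2) - φ i (X i + 1) := fun i =>
    sub_pos.2 (((hφ i).lt_iff (by linarith [hX i]) (by linarith [hX i])).2 (by linarith))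
  set D : ℝ := ∑ i, (φ i (X i + 2) - φ i (X i + 1))⁻¹ with hD
  have hDn : 0 ≤ D := Finset.sum_nonneg fun i _ => (inv_pos.2 (hD0 i)).le
  refine ⟨ε * a / (4 * (lam * D + 1)), by positivity, fun η hη hη0 x z hsol hev => ?_⟩
  rw [le_div_iff₀ (by positivity)] at hη0
  obtain ⟨T, hT0, hT⟩ := (hev.and (eventually_ge_atTop 0)).exists_forall_of_atTop.imp
    fun T h => And.intro (h T le_rfl).2 fun t ht => (h t ht).1
  obtain ⟨hx, -, hzS, hxn, hdx, hdz⟩ := id hsol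
  set ξ : ℝ → E → ℝ := fun t i => phiInv (φ i) (flowOf θ κ o d (z t) i) with hξ
  have hdom : ∀ t ≥ T, ∀ i, flowOf θ κ o d (z t) i ∈ latDom (φ i) := fun t ht i =>
    (mem_Zint_of_le hφ hm hX (hzS t (hT0.trans ht)) (hT t ht).1 (hT t ht).2).1.2 i
  have hfpos : ∀ t ≥ T, ∀ i, 0 < flowOf θ κ o d (z t) i := fun t ht i =>
    flowOf_pos hcover (fun γ => hm.trans_le ((hT t ht).1 γ)) i
  have hξX : ∀ t ≥ T, ∀ i, ξ t i ≤ X i := fun t ht i =>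
    (hφ i).phiInv_le (hfpos t ht i).le (hX i) ((hT t ht).2 i)
  have hξpos : ∀ t ≥ T, ∀ i, 0 < ξ t i := fun t ht i =>
    (hφ i).phiInv_pos (hdom t ht i) (hfpos t ht i)
  have hφξ : ∀ t ≥ T, ∀ i, φ i (ξ t i) = flowOf θ κ o d (z t) i := fun t ht i =>
    ((hφ i).phiInv_mem (hdom t ht i)).2
  set ξ' : ℝ → E → ℝ := fun t i => (deriv (φ i) (ξ t i))⁻¹ *
    (η * (flowOf θ κ o d (response φ ω F (x t)) i - flowOf θ κ o d (z t) i)) with hξ'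
  have hdξ : ∀ t ≥ T, ∀ i, HasDerivWithinAt (fun τ => ξ τ i) (ξ' t i) (Ici 0) t :=
    fun t ht i => ((hφ i).hasDerivAt_phiInv (hdom t ht i)
      (hfpos t ht i)).comp_hasDerivWithinAt t (hsol.hasDerivWithinAt_flowOf (hT0.trans ht) i)
  have hξ'le : ∀ t ≥ T, ∀ i, |ξ' t i| ≤ η * lam * (φ i (X i + 2) - φ i (X i + 1))⁻¹ := by
    intro t ht i
    have h1 := (hφ i).le_deriv (hξpos t ht i) (hξX t ht i)
    have h2 : (deriv (φ i) (ξ t i))⁻¹ ≤ (φ i (X i + 2) - φ i (X i + 1))⁻¹ :=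
      inv_anti₀ (hD0 i) h1
    have h3 : 0 ≤ (deriv (φ i) (ξ t i))⁻¹ := inv_nonneg.2 ((hD0 i).le.trans h1)
    have h4 := flowOf_nonneg (hzS t (hT0.trans ht)).1 i
    have h5 := flowOf_le (hzS t (hT0.trans ht)) i
    have h6 : response φ ω F (x t) ∈ pathSimplex lam (Path θ κ o d) := hF _ _
    have h7 := flowOf_nonneg h6.1 i
    have h8 := flowOf_le h6 i
    rw [hξ', abs_mul, abs_of_nonneg h3, abs_mul, abs_of_pos hη, mul_comm]
    exact mul_le_mul (mul_le_mul_of_nonneg_left (abs_le.2 ⟨by linarith, by linarith⟩) hη.le)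
      h2 h3 (by positivity)
  have habs : ∀ t, ∀ i, ∃ s : ℝ, t ≥ T → |s| ≤ 1 ∧ s * (x t i - ξ t i) = |x t i - ξ t i| ∧
      HasDerivWithinAt (fun τ => |x τ i - ξ τ i|) (s * (drift θ κ o d lam (z t)
        (fun j => φ j (x t j)) i - ξ' t i)) (Ici t) t := by
    intro t i
    by_cases ht : t ≥ T
    · obtain ⟨s, hs⟩ := hasDerivWithinAt_abs_Ici (((hdx t (hT0.trans ht) i).sub
        (hdξ t ht i)).mono (Ici_subset_Ici.2 (hT0.trans ht)))
      exact ⟨s, fun _ => hs⟩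
    · exact ⟨0, fun h => absurd h ht⟩
  choose s hs using habs
  have hsv : ∀ t ≥ T, ∀ i, s t i * (φ i (x t i) - flowOf θ κ o d (z t) i) =
      |φ i (x t i) - flowOf θ κ o d (z t) i| := by
    intro t ht i
    have hx0 := hxn t (hT0.trans ht) i
    have h1 := (hs t i ht).2.1
    rw [← hφξ t ht i]
    rcases lt_trichotomy (x t i) (ξ t i) with hlt | heq | hlt
    · have h2 := ((hφ i).lt_iff hx0 (hξpos t ht i).le).2 hlt
      rw [abs_of_neg (by linarith)] at h1 ⊢
      rw [← neg_one_mul] at h1 ⊢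
      rw [mul_right_cancel₀ (by linarith) h1]
    · simp [heq]
    · have h2 := ((hφ i).lt_iff (hξpos t ht i).le hx0).2 hlt
      rw [abs_of_pos (by linarith)] at h1 ⊢
      nth_rewrite 2 [← one_mul (x t i - ξ t i)] at h1
      rw [mul_right_cancel₀ (by linarith) h1, one_mul]
  have hev' := eventually_le_of_right_deriv (W := fun t => ∑ i, w i * |x t i - ξ t i|)
    (W' := fun t => ∑ i, w i * (s t i * (drift θ κ o d lam (z t)
        (fun j => φ j (x t j)) i - ξ' t i))) (T := T) (r := r) (b := ε * a / 2) (by positivity)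
    ?_ ?_ ?_
  · filter_upwards [hev'] with t ht i
    have h1 : w i * |x t i - ξ t i| ≤ r := (Finset.single_le_sum
      (f := fun i => w i * |x t i - ξ t i|) (fun i _ => mul_nonneg
        (zero_le_one.trans (hw1 i)) (abs_nonneg _)) (Finset.mem_univ i)).trans ht
    exact (le_mul_of_one_le_left (abs_nonneg _) (hw1 i)).trans h1
  · refine continuousOn_finsetSum _ fun i _ => continuousOn_const.mul (ContinuousOn.abs ?_)
    refine ContinuousOn.sub ?_ fun t ht => ?_
    · exact ((continuous_apply i).comp hx.continuous).continuousOn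
    · exact (hdξ t ht i).continuousWithinAt.mono (Ici_subset_Ici.2 hT0)
  · intro t ht
    exact HasDerivWithinAt.fun_sum fun i _ => ((hs t i ht).2.2).const_mul _
  · intro t ht hrt
    have hz := hzS t (hT0.trans ht)
    have hzp : ∀ γ, 0 < z t γ := fun γ => hm.trans_le ((hT t ht).1 γ)
    obtain ⟨i, hi⟩ : ∃ i, ρ ≤ |x t i - ξ t i| := by
      by_contra! hcon
      have h1 : ∑ i, w i * |x t i - ξ t i| ≤ ∑ _i : E, 2 * ρ :=
        Finset.sum_le_sum fun i _ => mul_le_mul (hw2 i) (hcon i).le (abs_nonneg _) zero_le_two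
      rw [Finset.sum_const, Finset.card_univ, nsmul_eq_mul, ← hn] at h1
      have h2 : 2 * ρ * (n + 1) = r := by rw [hρ]; field_simp
      nlinarith
    have h1 : a ≤ ∑ j, |φ j (x t j) - flowOf θ κ o d (z t) j| := by
      refine (hgap i).trans (((hφ i).gap_le (hξpos t ht i).le (hξX t ht i)
        (hxn t (hT0.trans ht) i) hρ0 hi).trans ?_)
      rw [hφξ t ht i]
      exact Finset.single_le_sum (f := fun j => |φ j (x t j) - flowOf θ κ o d (z t) j|)
        (fun j _ => abs_nonneg _) (Finset.mem_univ i)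
    have h2 := weighted_dissipation (v := fun j => φ j (x t j) - flowOf θ κ o d (z t) j)
      (s := s t) (fun i => zero_le_one.trans (hw1 i)) (fun i => Gsplit_nonneg hz.1 i)
      (hw _ hz (hT t ht).1) (fun i => (hs t i ht).1) (hsv t ht)
    have h3 : ∑ i, w i * (s t i * ξ' t i) ≥ -(2 * (η * lam * D)) := by
      rw [hD, Finset.mul_sum, Finset.mul_sum, ← Finset.sum_neg_distrib]
      refine Finset.sum_le_sum fun i _ => (abs_le.1 ?_).1
      rw [abs_mul, abs_mul, abs_of_nonneg (zero_le_one.trans (hw1 i))]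
      exact mul_le_mul (hw2 i) ((mul_le_of_le_one_left (abs_nonneg _) (hs t i ht).1).trans
        (hξ'le t ht i)) (by positivity) zero_le_two
    have h4 : ∀ i, w i * (s t i * (drift θ κ o d lam (z t) (fun j => φ j (x t j)) i - ξ' t i)) =
        w i * (s t i * (Gsplit θ κ o d (z t) i * (∑ j with κ j = θ i,
          (φ j (x t j) - flowOf θ κ o d (z t) j)) - (φ i (x t i) - flowOf θ κ o d (z t) i))) -
        w i * (s t i * ξ' t i) := fun i => by
      rw [drift_eq hcover hz hzp]; ring
    simp only [h4, Finset.sum_sub_distrib]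
    have h5 := mul_le_mul_of_nonneg_left h1 hε.le
    have h6 : η * (4 * (lam * D + 1)) = 4 * (η * lam * D) + 4 * η := by ring
    simp only [Finset.sum_sub_distrib] at h2
    linarith

end Dynamics

section Closed

variable {V E : Type*} {θ κ : E → V} {o d : V} [Fintype E] [DecidableEq E]
  [Fintype (Path θ κ o d)] {φ ω : E → ℝ → ℝ} {lam β η m : ℝ} {X c : E → ℝ}
  {F : (E → ℝ) → (E → ℝ) → Path θ κ o d → ℝ} {x : ℝ → E → ℝ} {z : ℝ → Path θ κ o d → ℝ}
  {K : Set (Path θ κ o d → ℝ)} {zs : Path θ κ o d → ℝ}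

theorem gradEnt_smul (a : ℝ) (z v : Path θ κ o d → ℝ) :
    gradEnt θ κ o d φ ω β z (a • v) = a * gradEnt θ κ o d φ ω β z v := by
  have h : ∀ i, flowOf θ κ o d (a • v) i = a * flowOf θ κ o d v i := fun i => by
    simp only [flowOf, Finset.mul_sum, Pi.smul_apply, smul_eq_mul]
    exact Finset.sum_congr rfl fun γ _ => by ring
  simp only [gradEnt, h, Pi.smul_apply, smul_eq_mul, mul_add, Finset.mul_sum]
  congr 1 <;> exact Finset.sum_congr rfl fun _ _ => by ring

theorem gradEnt_sub (z u v : Path θ κ o d → ℝ) :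
    gradEnt θ κ o d φ ω β z (u - v) = gradEnt θ κ o d φ ω β z u - gradEnt θ κ o d φ ω β z v := by
  simp only [gradEnt, ← flowOf_sub_flowOf, Pi.sub_apply, mul_sub, Finset.sum_sub_distrib]
  ring

theorem hasDerivWithinAt_gradEnt {z' : Path θ κ o d → ℝ} {s : Set ℝ} {t : ℝ}
    (hd : ∀ γ, HasDerivWithinAt (fun τ => z τ γ) (z' γ) s t) :
    HasDerivWithinAt (fun τ => gradEnt θ κ o d φ ω β zs (z τ)) (gradEnt θ κ o d φ ω β zs z')
      s t := by
  refine HasDerivWithinAt.add ?_ (HasDerivWithinAt.const_mul _ ?_)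
  · exact HasDerivWithinAt.fun_sum fun i _ => HasDerivWithinAt.const_mul _
      (HasDerivWithinAt.fun_sum fun γ _ => (hd γ).const_mul _)
  · exact HasDerivWithinAt.fun_sum fun γ _ => (hd γ).const_mul _

variable [DecidableEq V]

theorem IsSolution.hasDerivWithinAt_apply (hsol : IsSolution θ κ o d φ ω lam η F x z) {t : ℝ}
    (ht : 0 ≤ t) (γ : Path θ κ o d) :
    HasDerivWithinAt (fun τ => z τ γ) ((η • (response φ ω F (x t) - z t)) γ) (Ici 0) t :=
  hsol.2.2.2.2.2 t ht γ

/-- If the perceived costs are eventually close to those of the flow induced by the path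
preferences, the latter eventually get close to the minimizer of the entropic objective. -/
theorem IsSolution.eventually_sum_sq_le (hcover : ∀ i : E, ∃ γ : Path θ κ o d, i ∈ γ.1)
    (hφ : ∀ i, Standing (φ i)) (hmon : MonotonePolicy φ ω) (hlip : LipschitzPolicy φ ω)
    (hlam : 0 < lam) (hβ : 0 < β) (hη : 0 < η)
    (hsol : IsSolution θ κ o d φ ω lam η F x z)
    (hBR : IsPerturbedBR θ κ o d K (fun z => β⁻¹ * ∑ γ, z γ * Real.log (z γ)) F)
    (hK : K ⊆ Zint θ κ o d φ lam) (hzs : zs ∈ K)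
    (hopt : ∀ α ∈ K, 0 ≤ gradEnt θ κ o d φ ω β zs (α - zs)) {e : ℝ} (he : 0 < e)
    (hint : ∀ᶠ t in atTop, z t ∈ Zint θ κ o d φ lam)
    (hcost : ∀ᶠ t in atTop, ∀ i, |linkCost φ ω i (flowOf θ κ o d (z t) i) -
      linkCost φ ω i (φ i (x t i))| ≤ e) :
    ∀ᶠ t in atTop, ∑ γ, (z t γ - zs γ) ^ 2 ≤
      4 * lam * β * ((Fintype.card E * lam + 2) * e) := by
  obtain ⟨T, hT0, hT⟩ := ((hint.and hcost).and (eventually_ge_atTop 0)).exists_forall_of_atTop.imp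
    fun T h => And.intro (h T le_rfl).2 fun t ht => (h t ht).1
  have hR : ∀ t, response φ ω F (x t) ∈ K := fun t => (hBR _ _).1
  have h1 : ∀ᶠ t in atTop, entObj θ κ o d φ ω β (z t) ≤
      entObj θ κ o d φ ω β zs + Fintype.card E * (e * lam) + e := by
    refine eventually_le_of_deriv_le hη (lt_add_of_pos_right _ he) hT0 (fun t ht =>
      entObj_hasDerivWithinAt hcover hφ hlip (hT t ht).1
        fun γ => hsol.hasDerivWithinAt_apply (hT0.trans ht) γ) fun t ht => ?_
    rw [gradEnt_smul]
    refine mul_le_mul_of_nonneg_left (gradEnt_bestResponse_le hcover hφ hmon hlip hlam hβ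
      (hT t ht).1 (hK hzs) (hK (hR t)) ?_ (hT t ht).2) hη.le
    by_cases heq : zs = response φ ω F (x t)
    · rw [← heq]
    · exact ((hBR _ _).2 zs hzs heq).le
  have h2 : ∀ᶠ t in atTop,
      -(gradEnt θ κ o d φ ω β zs (z t) - gradEnt θ κ o d φ ω β zs zs) ≤ e := by
    refine eventually_le_of_deriv_le (e := 0) hη he hT0 (fun t ht =>
      ((hasDerivWithinAt_gradEnt fun γ => hsol.hasDerivWithinAt_apply
        (hT0.trans ht) γ).sub_const _).neg) fun t ht => ?_
    have := mul_nonneg hη.le (hopt _ (hR t))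
    rw [gradEnt_sub] at this
    simp only [gradEnt_smul, gradEnt_sub]
    linarith
  filter_upwards [h1, h2, hint] with t h1 h2 h3
  have h4 := entObj_sub_ge hcover hφ hmon hlip hβ (hK hzs) h3
  rw [gradEnt_sub] at h4
  have h5 : β⁻¹ * ((∑ γ, (z t γ - zs γ) ^ 2) / (4 * lam)) ≤
      (Fintype.card E * lam + 2) * e := by linarith
  rw [inv_mul_le_iff₀ hβ, div_le_iff₀ (by positivity)] at h5
  linarith

theorem euclNorm_nonneg {ι : Type*} [Fintype ι] (v : ι → ℝ) : 0 ≤ euclNorm v := Real.sqrt_nonneg _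

theorem euclNorm_le_sum_abs {ι : Type*} [Fintype ι] (v : ι → ℝ) : euclNorm v ≤ ∑ i, |v i| := by
  refine Real.sqrt_le_iff.2 ⟨Finset.sum_nonneg fun _ _ => abs_nonneg _, ?_⟩
  simp only [← sq_abs (v _)]
  exact Finset.sum_sq_le_sq_sum_of_nonneg fun _ _ => abs_nonneg _

omit [DecidableEq V] in
theorem exists_pos_le_of_isCompact (hK : IsCompact K) (hsub : K ⊆ Zint θ κ o d φ lam) :
    ∃ m > 0, ∀ z ∈ K, ∀ γ, m ≤ z γ := by
  have : ∀ γ, ∃ m > 0, ∀ z ∈ K, m ≤ z γ := by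
    intro γ
    rcases K.eq_empty_or_nonempty with rfl | hne
    · exact ⟨1, one_pos, by simp⟩
    · obtain ⟨z, hz, h⟩ := hK.exists_isMinOn hne (continuous_apply γ).continuousOn
      exact ⟨z γ, (hsub hz).2 γ, fun z' hz' => h hz'⟩
  choose m hm h using this
  obtain ⟨a, ha, har⟩ := exists_pos_forall_le hm
  exact ⟨a, ha, fun z hz γ => (har γ).trans (h γ z hz)⟩

/-- For small update rates, the flow eventually gets close to the perturbed equilibrium. -/
theorem exists_rate_flow_near (hcover : ∀ i : E, ∃ γ : Path θ κ o d, i ∈ γ.1)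
    (hφ : ∀ i, Standing (φ i)) (hmon : MonotonePolicy φ ω) (hlip : LipschitzPolicy φ ω)
    (hlam : 0 < lam) (hβ : 0 < β) (hcomp : IsCompact K)
    (hBR : IsPerturbedBR θ κ o d K (fun z => β⁻¹ * ∑ γ, z γ * Real.log (z γ)) F)
    (hK : K ⊆ Zint θ κ o d φ lam)
    (hcap : ∀ i, ∃ c : ℝ, ENNReal.ofReal c < cap (φ i) ∧ ∀ z ∈ K, flowOf θ κ o d z i ≤ c)
    (hzs : zs ∈ K) (hopt : ∀ α ∈ K, 0 ≤ gradEnt θ κ o d φ ω β zs (α - zs))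
    {ε : ℝ} (hε : 0 < ε) :
    ∃ η₀ > 0, ∀ η, 0 < η → η ≤ η₀ → ∀ x z, IsSolution θ κ o d φ ω lam η F x z →
      ∀ᶠ t in atTop, euclNorm (fun i => φ i (x t i) - flowOf θ κ o d zs i) ≤ ε := by
  obtain ⟨m, hm, hKm⟩ := exists_pos_le_of_isCompact hcomp hK
  choose c hc hKc using hcap
  choose X hX hcX using fun i => Standing.exists_lt_of_lt_cap (hc i)
  set n : ℝ := (Fintype.card E : ℝ) with hn
  set N : ℝ := (Fintype.card (Path θ κ o d) : ℝ) with hN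
  have hn0 : 0 ≤ n := by positivity
  have hN0 : 0 ≤ N := by positivity
  set q : ℝ := ε / (2 * (n + 1) * (N + 1)) with hq
  have hq0 : 0 < q := by positivity
  set e : ℝ := min (ε / (2 * (n + 1))) (q ^ 2 / (4 * lam * β * (n * lam + 2))) with he
  have he0 : 0 < e := by positivity
  obtain ⟨r, hr, hmod⟩ := exists_phi_linkCost_modulus (X := X) hφ hlip he0
  obtain ⟨η₀, hη₀, htrack⟩ := exists_rate_density_tracking (ω := ω) (F := F) hcover hφ hlam
    (half_pos hm) hX (fun l w => (hK (hBR l w).1).1.1) hr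
  refine ⟨η₀, hη₀, fun η hη hle x z hsol => ?_⟩
  have hev := hsol.eventually_mem hη (fun l w => (hBR l w).1) hm hKm
    (fun z hz i => hKc i z hz) hcX
  have hint : ∀ᶠ t in atTop, z t ∈ Zint θ κ o d φ lam := by
    filter_upwards [hev, eventually_ge_atTop 0] with t ht ht0
    exact mem_Zint_of_le hφ (half_pos hm) hX (hsol.2.2.1 t ht0) ht.1 ht.2
  have hclose : ∀ᶠ t in atTop, ∀ i, |φ i (x t i) - flowOf θ κ o d (z t) i| ≤ e ∧
      |linkCost φ ω i (flowOf θ κ o d (z t) i) - linkCost φ ω i (φ i (x t i))| ≤ e := by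
    filter_upwards [htrack η hη hle x z hsol hev, hev, hint, eventually_ge_atTop 0]
      with t h1 h2 h3 ht0 i
    have h4 := (hφ i).phiInv_mem (h3.1.2 i)
    have := hmod i (x t i) _ (hsol.2.2.2.1 t ht0 i) h4.1
      ((hφ i).phiInv_le (h3.1.2 i).1 (hX i) (h2.2 i)) (h1 i)
    rwa [h4.2] at this
  have hsq := hsol.eventually_sum_sq_le hcover hφ hmon hlip hlam hβ hη hBR hK hzs hopt he0 hint
    (hclose.mono fun t ht i => (ht i).2)
  filter_upwards [hsq, hclose] with t h1 h2
  have h3 : ∀ γ, |(z t - zs) γ| ≤ q := fun γ => by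
    refine abs_le_of_sq_le_sq ?_ hq0.le
    refine ((Finset.single_le_sum (f := fun γ => (z t γ - zs γ) ^ 2) (fun _ _ => sq_nonneg _)
      (Finset.mem_univ γ)).trans h1).trans ?_
    have : e ≤ q ^ 2 / (4 * lam * β * (n * lam + 2)) := min_le_right _ _
    rw [le_div_iff₀ (by positivity)] at this
    linarith
  have h4 : ∀ i, |φ i (x t i) - flowOf θ κ o d zs i| ≤ ε / (n + 1) := fun i => by
    have h5 : |flowOf θ κ o d (z t) i - flowOf θ κ o d zs i| ≤ N * q := by
      rw [flowOf_sub_flowOf]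
      refine (abs_flowOf_le _ i).trans ((Finset.sum_le_sum fun γ _ => h3 γ).trans ?_)
      simp [hN]
    have h6 : N * q ≤ (N + 1) * q := by nlinarith
    have h7 : (N + 1) * q = ε / (2 * (n + 1)) := by rw [hq]; field_simp
    have h8 : ε / (n + 1) = ε / (2 * (n + 1)) + ε / (2 * (n + 1)) := by field_simp; ring
    have h9 := (h2 i).1.trans (min_le_left _ _)
    have := abs_sub_le (φ i (x t i)) (flowOf θ κ o d (z t) i) (flowOf θ κ o d zs i)
    linarith
  refine (euclNorm_le_sum_abs _).trans ((Finset.sum_le_sum fun i _ => h4 i).trans ?_)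
  rw [Finset.sum_const, Finset.card_univ, nsmul_eq_mul, ← hn, mul_div_assoc',
    div_le_iff₀ (by positivity)]
  nlinarith

/-- The flows are eventually bounded, uniformly in the update rate and the initial condition. -/
theorem exists_eventual_flow_bound (hcover : ∀ i : E, ∃ γ : Path θ κ o d, i ∈ γ.1)
    (hφ : ∀ i, Standing (φ i)) (hlam : 0 < lam) (hm : 0 < m) :
    ∃ B : E → ℝ, ∀ η F x z, IsSolution θ κ o d φ ω lam η F x z →
      (∀ᶠ t in atTop, ∀ γ, m ≤ z t γ) → ∀ᶠ t in atTop, ∀ i, φ i (x t i) ≤ B i := by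
  classical
  obtain ⟨w, ε, hε, hw1, hw2, hw⟩ := exists_weights (θ := θ) (κ := κ) hcover hlam hm
  set M : ℝ := 2 * Fintype.card E * (lam + ∑ j with ¬ cap (φ j) = ⊤, (cap (φ j)).toReal) with hM
  have hY : ∀ i, ∃ Y, 0 ≤ Y ∧ (cap (φ i) = ⊤ → (M + 1) / ε < φ i Y) := fun i => by
    by_cases h : cap (φ i) = ⊤
    · obtain ⟨Y, h0, hY⟩ := Standing.exists_ge_of_cap_eq_top h ((M + 1) / ε)
      exact ⟨Y, h0, fun _ => hY⟩
    · exact ⟨0, le_rfl, fun h' => absurd h' h⟩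
  choose Y hY0 hY using hY
  set r : ℝ := ∑ i, 2 * Y i + 1 with hr
  have hr0 : 0 ≤ r := add_nonneg (Finset.sum_nonneg fun i _ => by linarith [hY0 i]) zero_le_one
  refine ⟨fun i => if cap (φ i) = ⊤ then φ i r else (cap (φ i)).toReal,
    fun η F x z hsol hev => ?_⟩
  obtain ⟨T, hT0, hT⟩ := (hev.and (eventually_ge_atTop 0)).exists_forall_of_atTop.imp
    fun T h => And.intro (h T le_rfl).2 fun t ht => (h t ht).1
  obtain ⟨hx, -, hzS, hxn, hdx, -⟩ := hsol
  have hW := eventually_le_of_right_deriv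
    (W := fun t => ∑ i with cap (φ i) = ⊤, w i * x t i)
    (W' := fun t => ∑ i with cap (φ i) = ⊤, w i * drift θ κ o d lam (z t)
        (fun j => φ j (x t j)) i) (T := T) (r := r) one_pos ?_ ?_ ?_
  · filter_upwards [hW, eventually_ge_atTop 0] with t ht ht0 i
    split_ifs with hi
    · refine ((hφ i).le_iff (hxn t ht0 i) hr0).2 ((le_mul_of_one_le_left (hxn t ht0 i)
        (hw1 i)).trans ((Finset.single_le_sum (f := fun i => w i * x t i) (fun j _ =>
          mul_nonneg (zero_le_one.trans (hw1 j)) (hxn t ht0 j)) ?_).trans ht))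
      simpa using hi
    · exact Standing.apply_le_toReal_cap hi (hxn t ht0 i)
  · exact continuousOn_finsetSum _ fun i _ => continuousOn_const.mul
      ((continuous_apply i).comp hx.continuous).continuousOn
  · intro t ht
    exact HasDerivWithinAt.fun_sum fun i _ => ((hdx t (hT0.trans ht) i).mono
      (Ici_subset_Ici.2 (hT0.trans ht))).const_mul _
  · intro t ht hrt
    have ht0 := hT0.trans ht
    have hz := hzS t ht0
    have hzp : ∀ γ, 0 < z t γ := fun γ => hm.trans_le (hT t ht γ)
    obtain ⟨i, hi, hiY⟩ : ∃ i, cap (φ i) = ⊤ ∧ Y i ≤ x t i := by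
      by_contra! hcon
      have h1 : ∑ i with cap (φ i) = ⊤, w i * x t i ≤ ∑ i with cap (φ i) = ⊤, 2 * Y i :=
        Finset.sum_le_sum fun i hi => mul_le_mul (hw2 i)
          (hcon i (by simpa using hi)).le (hxn t ht0 i) zero_le_two
      have h2 : ∑ i with cap (φ i) = ⊤, 2 * Y i ≤ ∑ i, 2 * Y i :=
        Finset.sum_le_sum_of_subset_of_nonneg (Finset.filter_subset _ _)
          fun i _ _ => by linarith [hY0 i]
      linarith
    have h1 := weighted_dissipation_on (y := fun j => φ j (x t j))
      (b := fun i => lam * (if θ i = o then 1 else 0)) (fun i => cap (φ i) = ⊤)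
      (fun i => zero_le_one.trans (hw1 i)) hw2 (fun i => Gsplit_nonneg hz.1 i)
      (fun i => Gsplit_le_one hcover hzp i)
      (fun i => by split_ifs <;> simp [hlam.le]) hlam.le (hw _ hz (hT t ht))
      (fun i => (hφ i).apply_nonneg (hxn t ht0 i))
    have h2 : ∑ j with ¬ cap (φ j) = ⊤, φ j (x t j) ≤
        ∑ j with ¬ cap (φ j) = ⊤, (cap (φ j)).toReal :=
      Finset.sum_le_sum fun j hj => Standing.apply_le_toReal_cap (by simpa using hj) (hxn t ht0 j)
    have h3 : 2 * Fintype.card E * (lam + ∑ j with ¬ cap (φ j) = ⊤, φ j (x t j)) ≤ M :=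
      mul_le_mul_of_nonneg_left (by linarith) (by positivity)
    have h4 : (M + 1) / ε ≤ ∑ j with cap (φ j) = ⊤, φ j (x t j) :=
      (((hY i hi).le.trans (((hφ i).le_iff (hY0 i) (hxn t ht0 i)).2 hiY))).trans
        (Finset.single_le_sum (f := fun j => φ j (x t j))
          (fun j _ => (hφ j).apply_nonneg (hxn t ht0 j)) (by simpa using hi))
    rw [div_le_iff₀ hε] at h4
    simp only [drift]
    linarith

/-- A family of sets of reals which is bounded above uniformly and small near zero is dominated
by a nondecreasing rate function vanishing at zero. -/
theorem exists_rate_function {S : ℝ → Set ℝ} {D : ℝ} (hD : ∀ η > 0, ∀ s ∈ S η, s ≤ D)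
    (hS : ∀ ε > 0, ∃ η₀ > 0, ∀ η, 0 < η → η ≤ η₀ → ∀ s ∈ S η, s ≤ ε) :
    ∃ δ : ℝ → ℝ, (∀ η, 0 < η → 0 ≤ δ η) ∧
      (∀ η₁ η₂, 0 < η₁ → η₁ ≤ η₂ → δ η₁ ≤ δ η₂) ∧
      Tendsto δ (nhdsWithin 0 (Set.Ioi 0)) (nhds 0) ∧ ∀ η > 0, ∀ s ∈ S η, s ≤ δ η := by
  set R : ℝ → Set ℝ := fun η => insert 0 {s | ∃ η', 0 < η' ∧ η' ≤ η ∧ s ∈ S η'} with hR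
  have hb : ∀ η, BddAbove (R η) := fun η => ⟨max 0 D, by
    rintro s (rfl | ⟨η', h1, -, h2⟩)
    · exact le_max_left _ _
    · exact (hD η' h1 s h2).trans (le_max_right _ _)⟩
  have h0 : ∀ η, 0 ≤ sSup (R η) := fun η => le_csSup (hb η) (mem_insert _ _)
  refine ⟨fun η => sSup (R η), fun η _ => h0 η, fun η₁ η₂ _ h => ?_, ?_, fun η hη s hs => ?_⟩
  · refine csSup_le_csSup (hb η₂) (insert_nonempty _ _) (insert_subset_insert ?_)
    rintro s ⟨η', h1, h2, h3⟩
    exact ⟨η', h1, h2.trans h, h3⟩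
  · rw [Metric.tendsto_nhds]
    intro ε hε
    obtain ⟨η₀, hη₀, h⟩ := hS (ε / 2) (half_pos hε)
    filter_upwards [Ioc_mem_nhdsGT hη₀] with η hη
    rw [Real.dist_eq, sub_zero, abs_of_nonneg (h0 η)]
    refine (csSup_le (insert_nonempty _ _) ?_).trans_lt (half_lt_self hε)
    rintro s (rfl | ⟨η', h1, h2, h3⟩)
    · exact (half_pos hε).le
    · exact h η' h1 (h2.trans hη.2) s h3
  · exact le_csSup (hb η) (mem_insert_of_mem _ ⟨η, hη, le_rfl, hs⟩)

/-- Stability of the perturbed equilibrium flow. -/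
theorem exists_stability_rate (hcover : ∀ i : E, ∃ γ : Path θ κ o d, i ∈ γ.1)
    (hφ : ∀ i, Standing (φ i)) (hmon : MonotonePolicy φ ω) (hlip : LipschitzPolicy φ ω)
    (hlam : 0 < lam) (hβ : 0 < β) (hcomp : IsCompact K)
    (hBR : IsPerturbedBR θ κ o d K (fun z => β⁻¹ * ∑ γ, z γ * Real.log (z γ)) F)
    (hK : K ⊆ Zint θ κ o d φ lam)
    (hcap : ∀ i, ∃ c : ℝ, ENNReal.ofReal c < cap (φ i) ∧ ∀ z ∈ K, flowOf θ κ o d z i ≤ c)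
    (hzs : zs ∈ K) (hopt : ∀ α ∈ K, 0 ≤ gradEnt θ κ o d φ ω β zs (α - zs)) :
    ∃ δ : ℝ → ℝ, (∀ η, 0 < η → 0 ≤ δ η) ∧
      (∀ η₁ η₂, 0 < η₁ → η₁ ≤ η₂ → δ η₁ ≤ δ η₂) ∧
      Tendsto δ (nhdsWithin 0 (Set.Ioi 0)) (nhds 0) ∧
      ∀ η > (0 : ℝ), ∀ x z, IsSolution θ κ o d φ ω lam η F x z →
        Filter.limsup (fun t => euclNorm (fun i => φ i (x t i) - flowOf θ κ o d zs i)) atTop ≤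
          δ η := by
  obtain ⟨m, hm, hKm⟩ := exists_pos_le_of_isCompact hcomp hK
  choose c hc hKc using hcap
  choose X hX hcX using fun i => Standing.exists_lt_of_lt_cap (hc i)
  obtain ⟨B, hB⟩ := exists_eventual_flow_bound (ω := ω) hcover hφ hlam (half_pos hm)
  have hlimsup : ∀ (x : ℝ → E → ℝ) (a : ℝ),
      (∀ᶠ t in atTop, euclNorm (fun i => φ i (x t i) - flowOf θ κ o d zs i) ≤ a) →
      Filter.limsup (fun t => euclNorm (fun i => φ i (x t i) - flowOf θ κ o d zs i)) atTop ≤ a :=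
    fun x a h => limsup_le_of_le (isCoboundedUnder_le_of_le atTop fun _ => euclNorm_nonneg _) h
  set S : ℝ → Set ℝ := fun η => {s | ∃ x z, IsSolution θ κ o d φ ω lam η F x z ∧
    s = Filter.limsup (fun t => euclNorm (fun i => φ i (x t i) - flowOf θ κ o d zs i)) atTop}
    with hS
  have hD : ∀ η > 0, ∀ s ∈ S η, s ≤ ∑ i, (B i + flowOf θ κ o d zs i) := by
    rintro η hη s ⟨x, z, hsol, rfl⟩
    have hev := hsol.eventually_mem hη (fun l w => (hBR l w).1) hm hKm
      (fun z hz i => hKc i z hz) hcX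
    refine hlimsup x _ ?_
    filter_upwards [hB η F x z hsol (hev.mono fun t ht => ht.1), eventually_ge_atTop 0]
      with t ht ht0
    refine (euclNorm_le_sum_abs _).trans (Finset.sum_le_sum fun i _ => ?_)
    have a1 := (hφ i).apply_nonneg (hsol.2.2.2.1 t ht0 i)
    have a2 := flowOf_nonneg (hK hzs).1.1.1 i
    exact abs_le.2 ⟨by linarith [ht i], by linarith [ht i]⟩
  have hsmall : ∀ ε > 0, ∃ η₀ > 0, ∀ η, 0 < η → η ≤ η₀ → ∀ s ∈ S η, s ≤ ε := by
    intro ε hε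
    obtain ⟨η₀, hη₀, h⟩ := exists_rate_flow_near hcover hφ hmon hlip hlam hβ hcomp hBR hK
      (fun i => ⟨c i, hc i, hKc i⟩) hzs hopt hε
    refine ⟨η₀, hη₀, ?_⟩
    rintro η hη hle s ⟨x, z, hsol, rfl⟩
    exact hlimsup x ε (h η hη hle x z hsol)
  obtain ⟨δ, h0, h1, h2, h3⟩ := exists_rate_function hD hsmall
  exact ⟨δ, h0, h1, h2, fun η hη x z hsol => h3 η hη _ ⟨x, z, hsol, rfl⟩⟩

end Closed

/-! ### Wardrop equilibria and the vanishing-noise limit -/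

theorem isCompact_pathSimplex (lam : ℝ) (Γ : Type*) [Fintype Γ] :
    IsCompact (pathSimplex lam Γ) := by
  refine (isCompact_Icc (a := (0 : Γ → ℝ)) (b := fun _ => lam)).of_isClosed_subset ?_
    fun z hz => ⟨fun γ => hz.1 γ, fun γ => le_of_mem_pathSimplex hz γ⟩
  have : pathSimplex lam Γ = (⋂ γ, {z | 0 ≤ z γ}) ∩ {z | ∑ γ, z γ = lam} := by
    ext z; simp [pathSimplex]
  rw [this]
  exact (isClosed_iInter fun γ => isClosed_le continuous_const (continuous_apply γ)).inter
    (isClosed_eq (continuous_finsetSum _ fun γ _ => continuous_apply γ) continuous_const)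

theorem exists_entropy_bound (lam : ℝ) (Γ : Type*) [Fintype Γ] :
    ∃ M, 0 ≤ M ∧ ∀ z ∈ pathSimplex lam Γ, ∀ z' ∈ pathSimplex lam Γ,
      ∑ γ, z' γ * Real.log (z' γ) - ∑ γ, z γ * Real.log (z γ) ≤ M := by
  have hc : Continuous fun z : Γ → ℝ => ∑ γ, z γ * Real.log (z γ) :=
    continuous_finsetSum _ fun γ _ => Real.continuous_mul_log.comp (continuous_apply γ)
  obtain ⟨C, hC⟩ := (isCompact_pathSimplex lam Γ).exists_bound_of_continuousOn hc.continuousOn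
  refine ⟨max 0 (C + C), le_max_left _ _, fun z hz z' hz' => le_max_of_le_right ?_⟩
  have h1 := (abs_le.1 (hC z hz)).1
  have h2 := (abs_le.1 (hC z' hz')).2
  linarith

section Equilibrium

variable {V E : Type*} {θ κ : E → V} {o d : V} [Fintype E] [DecidableEq E]
  [Fintype (Path θ κ o d)] {φ ω : E → ℝ → ℝ} {lam : ℝ}

theorem pathCost_eq (y : E → ℝ) (γ : Path θ κ o d) :
    pathCost θ κ o d φ ω y γ = ∑ i, linkCost φ ω i (y i) * Amat θ κ o d i γ :=
  Finset.sum_congr rfl fun _ _ => mul_comm _ _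

theorem IsGWE.variational [DecidableEq V] (hlam : 0 < lam) {y : E → ℝ}
    (h : IsGWE θ κ o d φ ω lam y) {z' : Path θ κ o d → ℝ}
    (hz' : z' ∈ pathSimplex lam (Path θ κ o d)) :
    0 ≤ ∑ i, linkCost φ ω i (y i) * (flowOf θ κ o d z' i - y i) := by
  obtain ⟨-, -, z, hz, hy, hopt⟩ := h
  simp only [mul_sub, Finset.sum_sub_distrib]
  rw [sum_mul_flowOf]
  nth_rewrite 3 [show y = fun i => flowOf θ κ o d z i from funext hy]
  rw [sum_mul_flowOf z (fun i => linkCost φ ω i (y i))]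
  simp only [← pathCost_eq]
  have h1 : ∑ γ, ∑ γ', z γ * z' γ' * pathCost θ κ o d φ ω y γ ≤
      ∑ γ, ∑ γ', z γ * z' γ' * pathCost θ κ o d φ ω y γ' := by
    refine Finset.sum_le_sum fun γ _ => Finset.sum_le_sum fun γ' _ => ?_
    rcases (hz.1 γ).eq_or_lt with h0 | h0
    · simp [← h0]
    · exact mul_le_mul_of_nonneg_left (hopt γ h0 γ') (mul_nonneg h0.le (hz'.1 γ'))
  have h2 : ∑ γ, ∑ γ', z γ * z' γ' * pathCost θ κ o d φ ω y γ =
      lam * ∑ γ, z γ * pathCost θ κ o d φ ω y γ := by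
    rw [← hz'.2, Finset.mul_sum]
    refine Finset.sum_congr rfl fun γ _ => ?_
    rw [Finset.sum_mul]
    exact Finset.sum_congr rfl fun γ' _ => by ring
  have h3 : ∑ γ, ∑ γ', z γ * z' γ' * pathCost θ κ o d φ ω y γ' =
      lam * ∑ γ, z' γ * pathCost θ κ o d φ ω y γ := by
    rw [← hz.2, Finset.sum_mul]
    refine Finset.sum_congr rfl fun γ _ => ?_
    rw [Finset.mul_sum]
    exact Finset.sum_congr rfl fun γ' _ => by ring
  rw [h2, h3] at h1
  exact sub_nonneg.2 (le_of_mul_le_mul_left h1 hlam)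

theorem IsGWE.unique [DecidableEq V] (hφ : ∀ i, Standing (φ i)) (hmon : MonotonePolicy φ ω)
    (hlam : 0 < lam) {y y' : E → ℝ} (h : IsGWE θ κ o d φ ω lam y)
    (h' : IsGWE θ κ o d φ ω lam y') : y' = y := by
  obtain ⟨z, hz, hy, -⟩ := h.2.2
  obtain ⟨z', hz', hy', -⟩ := h'.2.2
  have h1 := h.variational hlam hz'
  have h2 := h'.variational hlam hz
  simp only [← hy, ← hy'] at h1 h2
  have h3 : ∀ i ∈ Finset.univ, 0 ≤ (linkCost φ ω i (y' i) - linkCost φ ω i (y i)) *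
      (y' i - y i) := fun i _ => by
    have hs := (linkCost_strictMonoOn hφ hmon i).monotoneOn
    rcases le_total (y i) (y' i) with hle | hle
    · exact mul_nonneg (sub_nonneg.2 (hs (h.1 i) (h'.1 i) hle)) (sub_nonneg.2 hle)
    · exact mul_nonneg_of_nonpos_of_nonpos (sub_nonpos.2 (hs (h'.1 i) (h.1 i) hle))
        (sub_nonpos.2 hle)
  have h4 : ∑ i, (linkCost φ ω i (y' i) - linkCost φ ω i (y i)) * (y' i - y i) = 0 := by
    refine le_antisymm ?_ (Finset.sum_nonneg h3)
    have := add_nonneg h1 h2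
    rw [← Finset.sum_add_distrib] at this
    rw [← neg_nonneg, ← Finset.sum_neg_distrib]
    refine this.trans_eq (Finset.sum_congr rfl fun i _ => by ring)
  funext i
  have h5 := (Finset.sum_eq_zero_iff_of_nonneg h3).1 h4 i (Finset.mem_univ i)
  rcases mul_eq_zero.1 h5 with h6 | h6
  · exact (linkCost_strictMonoOn hφ hmon i).injOn (h'.1 i) (h.1 i) (sub_eq_zero.1 h6)
  · exact sub_eq_zero.1 h6

/-- A solution of the variational inequality over feasible path preferences is a generalized
Wardrop equilibrium. -/
theorem isGWE_of_variational [DecidableEq V] (hloop : ∀ i, θ i ≠ κ i)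
    (hφ : ∀ i, Standing (φ i)) {z : Path θ κ o d → ℝ}
    (hz : z ∈ Zfeas θ κ o d φ lam)
    (hvi : ∀ α ∈ Zfeas θ κ o d φ lam, 0 ≤ ∑ i, linkCost φ ω i (flowOf θ κ o d z i) *
      (flowOf θ κ o d α i - flowOf θ κ o d z i)) :
    IsGWE θ κ o d φ ω lam (fun i => flowOf θ κ o d z i) := by
  classical
  refine ⟨hz.2, flowOf_mem_eqFlow hloop hz.1, z, hz.1, fun _ => rfl, fun γ hγ γ' => ?_⟩
  choose X hX hXlt using fun i => Standing.exists_lt_of_lt_cap (hz.2 i).2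
  obtain ⟨a, ha, hag⟩ := exists_pos_forall_le (g := fun i => φ i (X i) - flowOf θ κ o d z i)
    fun i => sub_pos.2 (hXlt i)
  set ε := min a (z γ) with hε
  have hε0 : 0 < ε := lt_min ha hγ
  by_cases hne : γ' = γ
  · rw [hne]
  set v : Path θ κ o d → ℝ := Pi.single γ' 1 - Pi.single γ 1 with hv
  have hflow : ∀ i, flowOf θ κ o d (z + ε • v) i =
      flowOf θ κ o d z i + ε * (Amat θ κ o d i γ' - Amat θ κ o d i γ) := fun i => by
    have h1 : ∀ δ : Path θ κ o d, ∑ γ, Amat θ κ o d i γ * (Pi.single δ 1 : _ → ℝ) γ =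
        Amat θ κ o d i δ := fun δ => by simp [Pi.single_apply]
    simp only [flowOf, hv, Pi.add_apply, Pi.smul_apply, Pi.sub_apply, smul_eq_mul]
    rw [← h1 γ, ← h1 γ', ← Finset.sum_sub_distrib, Finset.mul_sum, ← Finset.sum_add_distrib]
    exact Finset.sum_congr rfl fun _ _ => by ring
  have hmem : z + ε • v ∈ Zfeas θ κ o d φ lam := by
    have hS : z + ε • v ∈ pathSimplex lam (Path θ κ o d) := by
      refine ⟨fun δ => ?_, ?_⟩
      · have h0 := hz.1.1 δ
        have h1 : ε ≤ z γ := min_le_right _ _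
        simp only [hv, Pi.add_apply, Pi.smul_apply, Pi.sub_apply, Pi.single_apply, smul_eq_mul]
        split_ifs with h2 h3 h3
        · linarith
        · linarith
        · subst h3; linarith
        · linarith
      · simp [hv, Finset.sum_add_distrib, ← Finset.mul_sum, hz.1.2]
    refine ⟨hS, fun i => (hφ i).mem_latDom_of_le (flowOf_nonneg hS.1 i) (hX i) ?_⟩
    have h1 : Amat θ κ o d i γ' - Amat θ κ o d i γ ≤ 1 := by
      linarith [Amat_nonneg i γ, Amat_le_one i γ']
    have h2 := mul_le_mul_of_nonneg_left h1 hε0.le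
    have h3 : ε ≤ φ i (X i) - flowOf θ κ o d z i := (min_le_left _ _).trans (hag i)
    refine (hflow i).trans_le ?_
    linarith
  have h := hvi _ hmem
  have e : ∀ i, linkCost φ ω i (flowOf θ κ o d z i) *
      (flowOf θ κ o d (z + ε • v) i - flowOf θ κ o d z i) =
      ε * (linkCost φ ω i (flowOf θ κ o d z i) * Amat θ κ o d i γ' -
        linkCost φ ω i (flowOf θ κ o d z i) * Amat θ κ o d i γ) := fun i => by
    rw [hflow]; ring
  simp only [e, ← Finset.mul_sum, Finset.sum_sub_distrib] at h
  rw [pathCost_eq, pathCost_eq]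
  exact sub_nonneg.1 (nonneg_of_mul_nonneg_right h hε0)

omit [DecidableEq E] in
theorem exists_linkCost_barrier (hφ : ∀ i, Standing (φ i)) (hmon : MonotonePolicy φ ω) (i : E)
    (lam A Q : ℝ) (hA : 0 ≤ A) :
    ∃ X, A ≤ X ∧ ∀ y ∈ latDom (φ i), y ≤ lam → φ i X < y → Q ≤ linkCost φ ω i y := by
  by_cases hcap : cap (φ i) = ⊤
  · obtain ⟨X, hX, hlt⟩ := Standing.exists_ge_of_cap_eq_top hcap lam
    refine ⟨max A X, le_max_left _ _, fun y hy hle hgt => absurd hle (not_le.2 ?_)⟩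
    exact (hlt.trans_le (((hφ i).le_iff hX (hA.trans (le_max_left _ _))).2
      (le_max_right _ _))).trans hgt
  · obtain ⟨X, hX, hlt⟩ := (hφ i).exists_latency_ge hcap Q
    refine ⟨max A X, le_max_left _ _, fun y hy _ hgt => ?_⟩
    obtain ⟨x, hx, rfl⟩ := (hφ i).exists_eq_of_mem_latDom hy
    rw [(hφ i).lt_iff (hA.trans (le_max_left _ _)) hx] at hgt
    exact (hlt x ((le_max_right _ _).trans hgt.le)).trans (latency_le_linkCost hmon i hy)

section Limit

variable {zs : ℝ → Path θ κ o d → ℝ} {M : ℝ}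
  (hzs : ∀ β > 0, zs β ∈ Zfeas θ κ o d φ lam)
  (hvi : ∀ α ∈ Zfeas θ κ o d φ lam, ∃ α' : ℝ → Path θ κ o d → ℝ, Tendsto α' atTop (𝓝 α) ∧
    ∀ β > 0, -(β⁻¹ * M) ≤ ∑ i, linkCost φ ω i (flowOf θ κ o d (zs β) i) *
      (flowOf θ κ o d (α' β) i - flowOf θ κ o d (zs β) i))

include hzs hvi

/-- Approximate solutions of the variational inequality eventually stay away from the link
capacities. -/
theorem exists_flow_barrier (hφ : ∀ i, Standing (φ i)) (hmon : MonotonePolicy φ ω) (hM : 0 ≤ M)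
    (hne : (Zfeas θ κ o d φ lam).Nonempty) :
    ∃ X : E → ℝ, (∀ i, 0 ≤ X i) ∧ ∀ᶠ β in atTop, ∀ i, flowOf θ κ o d (zs β) i ≤ φ i (X i) := by
  obtain ⟨α, hα⟩ := hne
  obtain ⟨α', hlim, h⟩ := hvi α hα
  choose A hA hAlt using fun i => Standing.exists_lt_of_lt_cap (hα.2 i).2
  set P : E → ℝ := fun i => linkCost φ ω i (φ i (A i)) * φ i (A i) with hP
  have hAd : ∀ i, φ i (A i) ∈ latDom (φ i) := fun i => (hφ i).apply_mem_latDom (hA i)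
  have hP0 : ∀ i, 0 ≤ P i := fun i => mul_nonneg (linkCost_nonneg hφ hmon i (hAd i)) (hAd i).1
  have hg : ∀ i, 0 < φ i (A i + 1) - φ i (A i) := fun i => (hφ i).slope_pos (hA i)
  choose X hX hXQ using fun i => exists_linkCost_barrier hφ hmon i lam (A i + 1)
    ((M + ∑ j, P j + 1) / (φ i (A i + 1) - φ i (A i))) (by linarith [hA i])
  have hX0 : ∀ i, 0 ≤ X i := fun i => by linarith [hA i, hX i]
  refine ⟨X, hX0, ?_⟩
  have hev : ∀ᶠ β in atTop, ∀ i, flowOf θ κ o d (α' β) i < φ i (A i) :=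
    eventually_all.2 fun i => (((continuous_flowOf i).tendsto α).comp hlim).eventually_lt_const
      (hAlt i)
  filter_upwards [hev, eventually_ge_atTop 1] with β hβ hβ1 i
  have hβ0 : 0 < β := by linarith
  have hz := hzs β hβ0
  by_contra! hcon
  have hC := linkCost_nonneg hφ hmon
  have hterm : ∀ j, linkCost φ ω j (flowOf θ κ o d (zs β) j) *
      (flowOf θ κ o d (α' β) j - flowOf θ κ o d (zs β) j) ≤ P j := fun j => by
    have hCj := hC j (hz.2 j)
    have hy0 : 0 ≤ flowOf θ κ o d (zs β) j := (hz.2 j).1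
    rcases le_total (flowOf θ κ o d (α' β) j) (flowOf θ κ o d (zs β) j) with hle | hle
    · exact (mul_nonpos_of_nonneg_of_nonpos hCj (sub_nonpos.2 hle)).trans (hP0 j)
    · exact mul_le_mul ((linkCost_strictMonoOn hφ hmon j).monotoneOn (hz.2 j) (hAd j)
        (hle.trans (hβ j).le)) (by linarith [hβ j]) (sub_nonneg.2 hle) (hC j (hAd j))
  have hCi : M + ∑ j, P j + 1 ≤ linkCost φ ω i (flowOf θ κ o d (zs β) i) *
      (φ i (A i + 1) - φ i (A i)) :=
    (div_le_iff₀ (hg i)).1 (hXQ i _ (hz.2 i) (flowOf_le hz.1 i) hcon)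
  have hi : linkCost φ ω i (flowOf θ κ o d (zs β) i) *
      (flowOf θ κ o d (α' β) i - flowOf θ κ o d (zs β) i) ≤ -(M + ∑ j, P j + 1) := by
    have h1 : φ i (A i + 1) ≤ φ i (X i) :=
      ((hφ i).le_iff (by linarith [hA i]) (hX0 i)).2 (hX i)
    have h2 : flowOf θ κ o d (α' β) i - flowOf θ κ o d (zs β) i ≤
        -(φ i (A i + 1) - φ i (A i)) := by linarith [hβ i]
    have := mul_le_mul_of_nonneg_left h2 (hC i (hz.2 i))
    simp only at this
    linarith
  have h1 := h β hβ0
  have h2 : ∑ j, (linkCost φ ω j (flowOf θ κ o d (zs β) j) *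
      (flowOf θ κ o d (α' β) j - flowOf θ κ o d (zs β) j) - P j) ≤
      linkCost φ ω i (flowOf θ κ o d (zs β) i) *
      (flowOf θ κ o d (α' β) i - flowOf θ κ o d (zs β) i) - P i := by
    rw [← Finset.add_sum_erase _ _ (Finset.mem_univ i)]
    exact add_le_of_nonpos_right (Finset.sum_nonpos fun j _ => sub_nonpos.2 (hterm j))
  rw [Finset.sum_sub_distrib] at h2
  have h3 : β⁻¹ * M ≤ M := mul_le_of_le_one_left hM (inv_le_one_of_one_le₀ hβ1)
  linarith [hP0 i]

/-- Limits of approximate solutions of the variational inequality are equilibria. -/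
theorem isGWE_of_tendsto [DecidableEq V] (hloop : ∀ i, θ i ≠ κ i) (hφ : ∀ i, Standing (φ i))
    (hmon : MonotonePolicy φ ω) (hlip : LipschitzPolicy φ ω) (hM : 0 ≤ M)
    (hne : (Zfeas θ κ o d φ lam).Nonempty) {l : Filter ℝ} [l.NeBot] (hl : l ≤ atTop)
    {z : Path θ κ o d → ℝ} (hz : Tendsto zs l (𝓝 z)) :
    IsGWE θ κ o d φ ω lam (fun i => flowOf θ κ o d z i) := by
  obtain ⟨X, hX0, hX⟩ := exists_flow_barrier hzs hvi hφ hmon hM hne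
  have hpos : ∀ᶠ β in l, 0 < β := hl (eventually_gt_atTop 0)
  have hzS : z ∈ pathSimplex lam (Path θ κ o d) :=
    (isCompact_pathSimplex lam _).isClosed.mem_of_tendsto hz
      (hpos.mono fun β hβ => (hzs β hβ).1)
  have hflow : ∀ i, Tendsto (fun β => flowOf θ κ o d (zs β) i) l (𝓝 (flowOf θ κ o d z i)) :=
    fun i => ((continuous_flowOf i).tendsto z).comp hz
  have hzf : z ∈ Zfeas θ κ o d φ lam := ⟨hzS, fun i => (hφ i).mem_latDom_of_le
    (flowOf_nonneg hzS.1 i) (hX0 i)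
    (le_of_tendsto (hflow i) ((hX.filter_mono hl).mono fun β h => h i))⟩
  refine isGWE_of_variational hloop hφ hzf fun α hα => ?_
  obtain ⟨α', hα', h⟩ := hvi α hα
  have hcost : ∀ i, Tendsto (fun β => linkCost φ ω i (flowOf θ κ o d (zs β) i)) l
      (𝓝 (linkCost φ ω i (flowOf θ κ o d z i))) := fun i =>
    (linkCost_continuousOn hφ hlip i _ (hzf.2 i)).tendsto.comp
      (tendsto_nhdsWithin_iff.2 ⟨hflow i, hpos.mono fun β hβ => (hzs β hβ).2 i⟩)
  have hlim := tendsto_finsetSum Finset.univ fun i _ => (hcost i).mul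
    (((((continuous_flowOf (θ := θ) (κ := κ) (o := o) (d := d) i).tendsto α).comp
      hα').mono_left hl).sub (hflow i))
  have hzero : Tendsto (fun β : ℝ => -(β⁻¹ * M)) l (𝓝 0) := by
    simpa using ((tendsto_inv_atTop_zero.mono_left hl).mul_const M).neg
  exact le_of_tendsto_of_tendsto hzero hlim (hpos.mono fun β hβ => h β hβ)

/-- Approximate solutions of the variational inequality converge to the unique equilibrium. -/
theorem exists_isGWE_tendsto [DecidableEq V] (hloop : ∀ i, θ i ≠ κ i)
    (hφ : ∀ i, Standing (φ i)) (hmon : MonotonePolicy φ ω) (hlip : LipschitzPolicy φ ω)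
    (hlam : 0 < lam) (hM : 0 ≤ M) (hne : (Zfeas θ κ o d φ lam).Nonempty) :
    ∃ yw, IsGWE θ κ o d φ ω lam yw ∧ (∀ y', IsGWE θ κ o d φ ω lam y' → y' = yw) ∧
      Tendsto (fun β i => flowOf θ κ o d (zs β) i) atTop (𝓝 yw) := by
  have key : ∀ u : Ultrafilter ℝ, ↑u ≤ (atTop : Filter ℝ) → ∃ yw, IsGWE θ κ o d φ ω lam yw ∧
      Tendsto (fun β i => flowOf θ κ o d (zs β) i) u (𝓝 yw) := by
    intro u hu
    have hmem : ∀ᶠ β in (u : Filter ℝ), zs β ∈ pathSimplex lam (Path θ κ o d) :=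
      hu ((eventually_gt_atTop 0).mono fun β hβ => (hzs β hβ).1)
    obtain ⟨z, -, hz⟩ := (isCompact_pathSimplex lam _).ultrafilter_le_nhds (u.map zs)
      (le_principal_iff.2 hmem)
    exact ⟨_, isGWE_of_tendsto hzs hvi hloop hφ hmon hlip hM hne hu hz,
      tendsto_pi_nhds.2 fun i => ((continuous_flowOf i).tendsto z).comp hz⟩
  obtain ⟨yw, hyw, -⟩ := key _ (Ultrafilter.of_le atTop)
  refine ⟨yw, hyw, fun y' hy' => hyw.unique hφ hmon hlam hy', ?_⟩
  rw [tendsto_iff_ultrafilter]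
  intro u hu
  obtain ⟨y, hy, hlim⟩ := key u hu
  rwa [hyw.unique hφ hmon hlam hy] at hlim

end Limit

/-- Minimizers of the entropic objective satisfy an approximate variational inequality. -/
theorem sum_linkCost_mul_ge_of_gradEnt_nonneg {β M : ℝ}
    {zs α : Path θ κ o d → ℝ} (hlam : 0 < lam) (hβ : 0 < β)
    (hM : ∀ z ∈ pathSimplex lam (Path θ κ o d), ∀ z' ∈ pathSimplex lam (Path θ κ o d),
      ∑ γ, z' γ * Real.log (z' γ) - ∑ γ, z γ * Real.log (z γ) ≤ M)
    (hzs : zs ∈ Zint θ κ o d φ lam) (hα : α ∈ Zint θ κ o d φ lam)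
    (h : 0 ≤ gradEnt θ κ o d φ ω β zs (α - zs)) :
    -(β⁻¹ * M) ≤ ∑ i, linkCost φ ω i (flowOf θ κ o d zs i) *
      (flowOf θ κ o d α i - flowOf θ κ o d zs i) := by
  have h1 := mul_le_mul_of_nonneg_left ((entropy_sub_ge' hlam hzs hα).trans
    (hM _ hzs.1.1 _ hα.1.1)) (inv_pos.2 hβ).le
  simp only [gradEnt, ← flowOf_sub_flowOf] at h
  linarith

/-- Points of a bounded set are limits of points of compact sets converging to its closure in the
Hausdorff distance. -/
theorem exists_tendsto_of_hausdorffDist {α : Type*} [MetricSpace α] {S : Set α}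
    {K : ℝ → Set α} (hS : Bornology.IsBounded S)
    (hK : ∀ β > 0, (K β).Nonempty ∧ IsCompact (K β))
    (hconv : Tendsto (fun β => Metric.hausdorffDist (K β) (closure S)) atTop (𝓝 0))
    {a : α} (ha : a ∈ S) :
    ∃ a' : ℝ → α, Tendsto a' atTop (𝓝 a) ∧ ∀ β > 0, a' β ∈ K β := by
  have key : ∀ β, ∃ a', 0 < β → a' ∈ K β ∧
      dist a' a ≤ Metric.hausdorffDist (K β) (closure S) := by
    intro β
    by_cases hβ : 0 < β
    · obtain ⟨hne, hc⟩ := hK β hβ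
      obtain ⟨a', ha', h⟩ := hc.exists_infDist_eq_dist hne a
      refine ⟨a', fun _ => ⟨ha', ?_⟩⟩
      rw [dist_comm, ← h, Metric.hausdorffDist_comm]
      exact Metric.infDist_le_hausdorffDist_of_mem (subset_closure ha)
        (Metric.hausdorffEDist_ne_top_of_nonempty_of_bounded ⟨a, subset_closure ha⟩ hne
          hS.closure hc.isBounded)
    · exact ⟨a, fun h => absurd h hβ⟩
  choose a' ha' using key
  refine ⟨a', tendsto_iff_dist_tendsto_zero.2 (squeeze_zero' (Eventually.of_forall fun _ =>
    dist_nonneg) ?_ hconv), fun β hβ => (ha' β hβ).1⟩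
  filter_upwards [eventually_gt_atTop 0] with β hβ using (ha' β hβ).2

end Equilibrium

/-- **Main theorem.** For each `β > 0` there is a perturbed equilibrium
flow `y^{(ω,β)} ∈ F` such that every solution of the closed-loop dynamics with update
rate `η` satisfies `limsup_{t→∞} ‖y(t) - y^{(ω,β)}‖₂ ≤ δ̄(η)` for a nondecreasing
function `δ̄` vanishing at `0+`; moreover `y^{(ω,β)} → y^{(ω)}`, the unique generalized
Wardrop equilibrium, as `β → ∞`. -/
theorem main_stability_theorem {V E : Type*} [Fintype V] [Fintype E]
    [DecidableEq V] [DecidableEq E] (θ κ : E → V) (hloop : ∀ i, θ i ≠ κ i)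
    (o d : V) (hod : d ≠ o) [Fintype (Path θ κ o d)]
    (hreach : Nonempty (Path θ κ o d))
    (hcover : ∀ i : E, ∃ γ : Path θ κ o d, i ∈ γ.1)
    (φ : E → ℝ → ℝ) (hφ : ∀ i, Standing (φ i))
    (ω : E → ℝ → ℝ) (hmon : MonotonePolicy φ ω) (hlip : LipschitzPolicy φ ω)
    (lam : ℝ) (hlam0 : 0 < lam) (hlam : ENNReal.ofReal lam < minCut θ κ o d φ)
    (Zb : ℝ → Set (Path θ κ o d → ℝ))
    (hZb : ∀ β > (0:ℝ), (Zb β).Nonempty ∧ IsCompact (Zb β) ∧ Convex ℝ (Zb β) ∧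
      Zb β ⊆ Zint θ κ o d φ lam ∧
      ∀ i, ∃ c : ℝ, ENNReal.ofReal c < cap (φ i) ∧ ∀ z ∈ Zb β, flowOf θ κ o d z i ≤ c)
    (hconv : Tendsto (fun β => Metric.hausdorffDist (Zb β)
        (closure (Zfeas θ κ o d φ lam))) atTop (nhds 0))
    (Fh : ℝ → (E → ℝ) → (E → ℝ) → Path θ κ o d → ℝ)
    (hFh : ∀ β > (0:ℝ), IsPerturbedBR θ κ o d (Zb β)
      (fun z => β⁻¹ * ∑ γ, z γ * Real.log (z γ)) (Fh β)) :
    ∃ yb : ℝ → E → ℝ,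
      (∀ β > (0:ℝ), yb β ∈ feas φ ∧
        ∃ δbar : ℝ → ℝ, (∀ η, 0 < η → 0 ≤ δbar η) ∧
          (∀ η₁ η₂, 0 < η₁ → η₁ ≤ η₂ → δbar η₁ ≤ δbar η₂) ∧
          Tendsto δbar (nhdsWithin 0 (Set.Ioi 0)) (nhds 0) ∧
          ∀ η > (0:ℝ), ∀ x z, IsSolution θ κ o d φ ω lam η (Fh β) x z →
            z 0 ∈ Zint θ κ o d φ lam →
            Filter.limsup (fun t => euclNorm (fun i => φ i (x t i) - yb β i)) atTop ≤
              δbar η) ∧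
      ∃ yw, IsGWE θ κ o d φ ω lam yw ∧ (∀ y', IsGWE θ κ o d φ ω lam y' → y' = yw) ∧
        Tendsto (fun β => yb β) atTop (nhds yw) := by
  have hmin : ∀ β, ∃ zs, 0 < β → zs ∈ Zb β ∧
      ∀ α ∈ Zb β, 0 ≤ gradEnt θ κ o d φ ω β zs (α - zs) := by
    intro β
    by_cases hβ : 0 < β
    · obtain ⟨hne, hc, hcvx, hsub, -⟩ := hZb β hβ
      obtain ⟨zs, h1, h2⟩ := exists_minimizer (β := β) hcover hφ hlip hne hc hcvx hsub
      exact ⟨zs, fun _ => ⟨h1, h2⟩⟩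
    · exact ⟨0, fun h => absurd h hβ⟩
  choose zs hzs using hmin
  have hZint : ∀ β > 0, zs β ∈ Zint θ κ o d φ lam := fun β hβ =>
    (hZb β hβ).2.2.2.1 (hzs β hβ).1
  obtain ⟨M, hM0, hM⟩ := exists_entropy_bound lam (Path θ κ o d)
  refine ⟨fun β i => flowOf θ κ o d (zs β) i, fun β hβ => ⟨(hZint β hβ).1.2, ?_⟩, ?_⟩
  · obtain ⟨-, hc, -, hsub, hcap⟩ := hZb β hβ
    obtain ⟨δ, h0, hm, hlim, hsol⟩ := exists_stability_rate hcover hφ hmon hlip hlam0 hβ hc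
      (hFh β hβ) hsub hcap (hzs β hβ).1 (hzs β hβ).2
    exact ⟨δ, h0, hm, hlim, fun η hη x z hxz _ => hsol η hη x z hxz⟩
  · refine exists_isGWE_tendsto (M := M) (fun β hβ => (hZint β hβ).1) (fun α hα => ?_) hloop hφ
      hmon hlip hlam0 hM0 ⟨_, (hZint 1 one_pos).1⟩
    obtain ⟨α', hlim, hα'⟩ := exists_tendsto_of_hausdorffDist
      ((isCompact_pathSimplex lam _).isBounded.subset fun z hz => hz.1)
      (fun β hβ => ⟨(hZb β hβ).1, (hZb β hβ).2.1⟩) hconv hα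
    exact ⟨α', hlim, fun β hβ => sum_linkCost_mul_ge_of_gradEnt_nonneg hlam0 hβ hM (hZint β hβ)
      ((hZb β hβ).2.2.2.1 (hα' β hβ)) ((hzs β hβ).2 _ (hα' β hβ))⟩

end Traffic
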